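/- arXiv:1301.3595 — 3 statements merged into one kernel-verified Lean document; each statement's English description precedes it below -/
import Mathlib

section
/- For every real α > 0, the set F(α) = {β > 1 : limsup_{n→∞} ℓ_n(β)/n ≥ α} has Hausdorff dimension 1/(1+α). -/
open Filter MeasureTheory Set
open scoped ENNReal

/-- The β-transformation `T_β x = βx - ⌊βx⌋`. -/
noncomputable def betaT (β : ℝ) : ℝ → ℝ := fun x => β * x - (⌊β * x⌋ : ℝ)

/-- The digits of the β-expansion of 1: `epsDig β i = ε_{i+1}(1,β) = ⌊β · T_β^i 1⌋`. -/
noncomputable def epsDig (β : ℝ) (i : ℕ) : ℕ := (⌊β * (betaT β)^[i] 1⌋).toNat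

/-- Strict lexicographic order on words of length `m` (identified with their
extensions by zeros). -/
def wordLexLt (m : ℕ) (a b : ℕ → ℕ) : Prop :=
  ∃ k < m, (∀ j < k, a j = b j) ∧ a k < b k

/-- Non-strict lexicographic order on words of length `m`. -/
def wordLexLe (m : ℕ) (a b : ℕ → ℕ) : Prop :=
  wordLexLt m a b ∨ ∀ j < m, a j = b j

/-- A word `w = (w 0, …, w (n-1))` is self-admissible if `σ^i w ⪯ (w 0, …, w (n-1-i))`
for all `0 ≤ i < n`. -/
def SelfAdmissible (n : ℕ) (w : ℕ → ℕ) : Prop :=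
  ∀ i < n, wordLexLe (n - i) (fun j => w (i + j)) w

/-- The recurrence time `τ(w)` of a word of length `n`: the least `1 ≤ k < n` with
`σ^k w = (w 0, …, w (n-1-k))`, and `n` if no such `k` exists. -/
noncomputable def recTime (n : ℕ) (w : ℕ → ℕ) : ℕ :=
  sInf ({k | 1 ≤ k ∧ k < n ∧ ∀ j < n - k, w (k + j) = w j} ∪ {n})

/-- The cylinder of order `n` in the parameter space: the set of `β > 1` whose
β-expansion of 1 starts with the word `w`. -/
def cylP (n : ℕ) (w : ℕ → ℕ) : Set ℝ := {β | 1 < β ∧ ∀ i < n, epsDig β i = w i}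

open Classical in
/-- The infinite β-expansion of 1: if the expansion of 1 is finite with last
nonzero digit at (0-indexed) position `m`, it is `(ε_1, …, ε_m, ε_{m+1} - 1)^∞`;
otherwise it is the expansion of 1 itself. -/
noncomputable def epsStar (β : ℝ) : ℕ → ℕ :=
  if h : ∃ m, epsDig β m ≠ 0 ∧ ∀ i, m < i → epsDig β i = 0 then
    fun i => if i % (h.choose + 1) = h.choose then epsDig β h.choose - 1
             else epsDig β (i % (h.choose + 1))
  else epsDig β

/-- `runLenStar β n` is the number of consecutive zeros in `ε*(1,β)` just after
(1-indexed) index `n`, i.e. the largest `k` with `ε*_{n+1} = … = ε*_{n+k} = 0`. -/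
noncomputable def runLenStar (β : ℝ) (n : ℕ) : ℕ :=
  sSup {k | ∀ j < k, epsStar β (n + j) = 0}

/-- `runLen β n` is the number of consecutive zeros in `ε(1,β)` just after
(1-indexed) index `n`. -/
noncomputable def runLen (β : ℝ) (n : ℕ) : ℕ :=
  sSup {k | ∀ j < k, epsDig β (n + j) = 0}

/-- Strict lexicographic order on infinite sequences. -/
def seqLexLt (a b : ℕ → ℕ) : Prop := ∃ k, (∀ j < k, a j = b j) ∧ a k < b k

/-- Non-strict lexicographic order on infinite sequences. -/
def seqLexLe (a b : ℕ → ℕ) : Prop := seqLexLt a b ∨ a = b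

/-- The β-shift `S_β` (via Parry's criterion): all sequences whose every shift is
lexicographically at most `ε*(1,β)`. -/
def Sbeta (β : ℝ) : Set (ℕ → ℕ) := {w | ∀ i, seqLexLe (fun j => w (i + j)) (epsStar β)}


/-! ### Basic facts on the orbit of 1 -/

lemma bx_nonneg (β : ℝ) (i : ℕ) : 0 ≤ (betaT β)^[i] 1 := by
  cases i with
  | zero => simp
  | succ i =>
    rw [Function.iterate_succ_apply']
    exact sub_nonneg.2 (Int.floor_le _)

lemma bx_lt_one (β : ℝ) (i : ℕ) : (betaT β)^[i+1] 1 < 1 := by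
  rw [Function.iterate_succ_apply']
  have := Int.lt_floor_add_one (β * (betaT β)^[i] 1)
  simp only [betaT] at *
  linarith

lemma bx_le_one (β : ℝ) (i : ℕ) : (betaT β)^[i] 1 ≤ 1 := by
  cases i with
  | zero => simp
  | succ i => exact (bx_lt_one β i).le

lemma bx_rec {β : ℝ} (hβ : 1 < β) (i : ℕ) :
    β * (betaT β)^[i] 1 = (epsDig β i : ℝ) + (betaT β)^[i+1] 1 := by
  have h0 : 0 ≤ ⌊β * (betaT β)^[i] 1⌋ :=
    Int.floor_nonneg.2 (mul_nonneg (by linarith) (bx_nonneg β i))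
  have h1 : ((epsDig β i : ℕ) : ℝ) = ((⌊β * (betaT β)^[i] 1⌋ : ℤ) : ℝ) := by
    unfold epsDig
    exact_mod_cast congrArg (fun z : ℤ => (z : ℝ)) (Int.toNat_of_nonneg h0)
  rw [h1, Function.iterate_succ_apply']
  simp only [betaT]
  ring

/-- Two parameters sharing the first `m+1` digits are close. -/
lemma cyl_close {β β' : ℝ} (hβ : 1 < β) (hlt : β < β') (m : ℕ)
    (h : ∀ i < m + 1, epsDig β i = epsDig β' i) :
    (β' - β) * β' ^ m ≤ (betaT β')^[m+1] 1 - (betaT β)^[m+1] 1 := by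
  induction m with
  | zero =>
    have h1 := bx_rec hβ 0
    have h2 := bx_rec (hβ.trans hlt) 0
    rw [h 0 (by norm_num)] at h1
    simp only [Function.iterate_zero, id] at h1 h2
    simp only [pow_zero, mul_one]
    linarith
  | succ m ih =>
    have ih := ih (fun i hi => h i (by omega))
    have h1 := bx_rec hβ (m+1)
    have h2 := bx_rec (hβ.trans hlt) (m+1)
    rw [h (m+1) (by omega)] at h1
    have h3 := bx_nonneg β (m+1)
    rw [pow_succ]
    have h4 : 0 < β' := by linarith
    nlinarith [mul_le_mul_of_nonneg_right ih h4.le]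

lemma cyl_dist {β₀ β β' : ℝ} (h0 : 1 < β₀) (hβ : β₀ < β) (hβ' : β₀ < β') (m : ℕ)
    (h : ∀ i < m + 1, epsDig β i = epsDig β' i) :
    dist β β' ≤ (β₀ ^ m)⁻¹ := by
  wlog hlt : β < β' generalizing β β'
  · rcases eq_or_lt_of_le (not_lt.1 hlt) with he | hl
    · subst he; simp; positivity
    · rw [dist_comm]; exact this hβ' hβ (fun i hi => (h i hi).symm) hl
  have h1 := cyl_close (h0.trans hβ) hlt m h
  have h2 := bx_lt_one β' m
  have h3 := bx_nonneg β (m+1)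
  rw [dist_comm, Real.dist_eq, abs_of_pos (by linarith)]
  rw [← one_div, le_div_iff₀ (by positivity)]
  have h4 : β₀ ^ m ≤ β' ^ m := by gcongr
  nlinarith [mul_le_mul_of_nonneg_left h4 (sub_nonneg.2 hlt.le)]

/-- Truncated digit sums evaluated in another base. -/
noncomputable def truncSum (β γ : ℝ) (k n : ℕ) : ℝ :=
  ∑ i ∈ Finset.range n, (epsDig β (k + i) : ℝ) * (γ ^ (i + 1))⁻¹

lemma truncSum_succ (β γ : ℝ) (k n : ℕ) :
    truncSum β γ k (n+1) = ((epsDig β k : ℝ) + truncSum β γ (k+1) n) * γ⁻¹ := by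
  unfold truncSum
  rw [Finset.sum_range_succ', add_mul, Finset.sum_mul, add_comm]
  congr 1
  · simp
  · refine Finset.sum_congr rfl fun i _ => ?_
    rw [show k + 1 + i = k + (i+1) by ring, pow_succ γ (i+1), mul_inv, mul_assoc]

lemma truncSum_nonneg {β γ : ℝ} (hγ : 0 < γ) (k n : ℕ) : 0 ≤ truncSum β γ k n := by
  unfold truncSum; positivity

lemma truncSum_le {β γ : ℝ} (hβ : 1 < β) (hγ : β ≤ γ) (n k : ℕ) :
    truncSum β γ k n ≤ β / γ * (betaT β)^[k] 1 := by
  have hγ0 : 0 < γ := by linarith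
  induction n generalizing k with
  | zero => simp only [truncSum, Finset.range_zero, Finset.sum_empty]
            have := bx_nonneg β k
            positivity
  | succ n ih =>
    rw [truncSum_succ, div_mul_eq_mul_div, bx_rec hβ k, div_eq_mul_inv]
    gcongr
    refine (ih (k+1)).trans ?_
    have := bx_nonneg β (k+1)
    have h2 : β / γ ≤ 1 := (div_le_one hγ0).2 hγ
    nlinarith

lemma truncSum_sep {β₁ β β' γ : ℝ} (hβ : 1 < β) (hβ' : 1 < β') (h1 : β < β₁) (h1' : β' < β₁)
    (hγ : β₁ < γ) (n k : ℕ) (hne : ∃ i < n, epsDig β (k+i) ≠ epsDig β' (k+i)) :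
    (1 - β₁ / γ) * (γ ^ n)⁻¹ ≤ |truncSum β γ k n - truncSum β' γ k n| := by
  have hγ1 : 1 < γ := by linarith
  have hγ0 : 0 < γ := by linarith
  induction n generalizing k with
  | zero => obtain ⟨i, hi, _⟩ := hne; omega
  | succ n ih =>
    rw [truncSum_succ, truncSum_succ, ← sub_mul, abs_mul, abs_of_pos (inv_pos.2 hγ0),
      pow_succ, mul_inv, ← mul_assoc]
    refine mul_le_mul_of_nonneg_right ?_ (inv_pos.2 hγ0).le
    by_cases he : epsDig β k = epsDig β' k
    · rw [he, add_sub_add_left_eq_sub]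
      apply ih
      obtain ⟨i, hi, hn⟩ := hne
      cases i with
      | zero => exact absurd he (by simpa using hn)
      | succ i => exact ⟨i, by omega, by rwa [show k + 1 + i = k + (i+1) by ring]⟩
    · have hb : ∀ b : ℝ, 1 < b → b < β₁ → truncSum b γ (k+1) n ≤ β₁ / γ := by
        intro b hb hb1
        refine (truncSum_le hb (by linarith) n (k+1)).trans ?_
        have := bx_le_one b (k+1)
        have := bx_nonneg b (k+1)
        have h3 : b / γ ≤ β₁ / γ := by gcongr
        have h4 : 0 ≤ b / γ := by positivity
        nlinarith
      have a1 := hb β hβ h1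
      have a2 := hb β' hβ' h1'
      have b1 := truncSum_nonneg (β := β) hγ0 (k+1) n
      have b2 := truncSum_nonneg (β := β') hγ0 (k+1) n
      have c1 : (1 - β₁ / γ) * (γ ^ n)⁻¹ ≤ 1 - β₁ / γ := by
        refine mul_le_of_le_one_right ?_ (inv_le_one_of_one_le₀ (one_le_pow₀ hγ1.le))
        have := (div_lt_one hγ0).2 hγ
        linarith
      refine c1.trans ?_
      rcases lt_or_gt_of_ne he with hl | hl
      · have : (epsDig β k : ℝ) + 1 ≤ epsDig β' k := by exact_mod_cast hl
        rw [abs_sub_comm]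
        refine le_trans ?_ (le_abs_self _)
        linarith
      · have : (epsDig β' k : ℝ) + 1 ≤ epsDig β k := by exact_mod_cast hl
        refine le_trans ?_ (le_abs_self _)
        linarith

/-- A code for the first `n` digits. -/
noncomputable def wcode (c γ : ℝ) (n : ℕ) (β : ℝ) : ℕ := ⌊truncSum β γ 0 n * (γ ^ n / c)⌋₊

lemma wcode_inj {β₁ β β' γ : ℝ} (hβ : 1 < β) (hβ' : 1 < β') (h1 : β < β₁) (h1' : β' < β₁)
    (hγ : β₁ < γ) (n : ℕ) (h : wcode (1 - β₁/γ) γ n β = wcode (1 - β₁/γ) γ n β') :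
    ∀ i < n, epsDig β i = epsDig β' i := by
  by_contra! hc
  have hs := truncSum_sep hβ hβ' h1 h1' hγ n 0 (by simpa using hc)
  have hγ0 : 0 < γ := by linarith
  set c := 1 - β₁/γ with hc'
  have hc0 : 0 < c := by
    have := (div_lt_one hγ0).2 hγ
    linarith
  have n1 := truncSum_nonneg (β := β) hγ0 0 n
  have n2 := truncSum_nonneg (β := β') hγ0 0 n
  set X := truncSum β γ 0 n
  set Y := truncSum β' γ 0 n
  have hK : 0 < γ ^ n / c := by positivity
  have e1 : (1:ℝ) ≤ |X * (γ^n/c) - Y * (γ^n/c)| := by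
    rw [← sub_mul, abs_mul, abs_of_pos hK]
    calc (1:ℝ) = c * (γ^n)⁻¹ * (γ^n/c) := by field_simp
      _ ≤ _ := by gcongr
  unfold wcode at h
  have f1 := Nat.floor_le (a := X * (γ^n/c)) (by positivity)
  have f2 := Nat.floor_le (a := Y * (γ^n/c)) (by positivity)
  have g1 := Nat.lt_floor_add_one (X * (γ^n/c))
  have g2 := Nat.lt_floor_add_one (Y * (γ^n/c))
  rw [h] at f1 g1
  have : |X * (γ^n/c) - Y * (γ^n/c)| < 1 := by rw [abs_lt]; constructor <;> linarith
  linarith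

lemma wcode_lt {β₁ β γ : ℝ} (hβ : 1 < β) (h1 : β < β₁)
    (hγ : β₁ < γ) (n : ℕ) : wcode (1 - β₁/γ) γ n β < ⌊γ ^ n / (1 - β₁/γ)⌋₊ + 1 := by
  have hγ0 : 0 < γ := by linarith
  have hc0 : 0 < 1 - β₁/γ := by
    have := (div_lt_one hγ0).2 hγ
    linarith
  refine Nat.lt_succ_of_le (Nat.floor_le_floor ?_)
  refine mul_le_of_le_one_left (by positivity) ?_
  refine (truncSum_le hβ (by linarith) n 0).trans ?_
  simp only [Function.iterate_zero, id, mul_one]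
  exact (div_le_one hγ0).2 (by linarith)

open scoped NNReal Topology

/-! ### Upper bound -/

lemma dimH_le_of_limsup_cover {A : Set ℝ} {s : ℝ≥0} (Q : ℕ → ℕ) (D : ℕ → ℝ)
    (hD0 : ∀ n, 0 ≤ D n) (hDa : Antitone D) (hD : Tendsto D atTop (𝓝 0))
    (S : ∀ n, Fin (Q n) → Set ℝ) (hdiam : ∀ n i, Metric.ediam (S n i) ≤ ENNReal.ofReal (D n))
    (hcov : ∀ x ∈ A, ∃ᶠ n in atTop, ∃ i, x ∈ S n i)
    (hsum : Summable fun n => (Q n : ℝ) * D n ^ (s : ℝ)) : dimH A ≤ s := by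
  apply dimH_le_of_hausdorffMeasure_ne_top
  have h1 := Measure.hausdorffMeasure_le_liminf_tsum
    (ι := fun N : ℕ => (n : ℕ) × Fin (Q (n + N))) (s : ℝ) A (l := atTop)
    (fun N => ENNReal.ofReal (D N)) (by simpa using ENNReal.tendsto_ofReal hD)
    (fun N i => S (i.1 + N) i.2)
    (Eventually.of_forall fun N i => (hdiam _ _).trans
      (ENNReal.ofReal_le_ofReal (hDa (by omega))))
    (Eventually.of_forall fun N x hx => by
      obtain ⟨n, hn, i, hi⟩ := frequently_atTop.1 (hcov x hx) N
      obtain ⟨k, rfl⟩ := Nat.exists_eq_add_of_le' hn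
      exact mem_iUnion.2 ⟨⟨k, i⟩, hi⟩)
  refine ne_top_of_le_ne_top ?_ (h1.trans (liminf_le_of_frequently_le'
    (x := ∑' n, ENNReal.ofReal ((Q n : ℝ) * D n ^ (s : ℝ))) (Eventually.frequently ?_)))
  · exact hsum.tsum_ofReal_ne_top
  · refine Eventually.of_forall fun N => ?_
    rw [ENNReal.tsum_sigma']
    calc ∑' n, ∑' i : Fin (Q (n + N)), Metric.ediam (S (n+N) i) ^ (s : ℝ)
        ≤ ∑' n, ENNReal.ofReal ((Q (n + N) : ℝ) * D (n + N) ^ (s : ℝ)) := by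
          refine ENNReal.tsum_le_tsum fun n => ?_
          rw [tsum_fintype]
          calc ∑ i : Fin (Q (n + N)), Metric.ediam (S (n+N) i) ^ (s : ℝ)
              ≤ ∑ i : Fin (Q (n + N)), ENNReal.ofReal (D (n+N)) ^ (s : ℝ) := by
                refine Finset.sum_le_sum fun i _ => ?_
                exact ENNReal.rpow_le_rpow (hdiam _ _) s.2
            _ = _ := by
                rw [Finset.sum_const, Finset.card_univ, Fintype.card_fin, nsmul_eq_mul,
                  ENNReal.ofReal_mul (by positivity), ENNReal.ofReal_natCast,
                  ENNReal.ofReal_rpow_of_nonneg (hD0 _) s.coe_nonneg]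
      _ ≤ _ := ENNReal.tsum_comp_le_tsum_of_injective (add_left_injective N)
          (fun n => ENNReal.ofReal ((Q n : ℝ) * D n ^ (s : ℝ)))

/-- Parameters whose expansion of 1 infinitely often has a long run of zeros. -/
def zeroRunSet (a : ℝ) : Set ℝ :=
  {β | 1 < β ∧ ∃ᶠ n : ℕ in atTop, ∀ j : ℕ, (j : ℝ) < a * n → epsDig β (n + j) = 0}

lemma dimH_local {a : ℝ} (ha : 0 < a) {s : ℝ≥0} {β₀ β₁ γ : ℝ} (h0 : 1 < β₀) (h1 : β₁ < γ)
    (h01 : β₀ < β₁) (hγ : γ < β₀ ^ ((1 + a) * s)) :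
    dimH (zeroRunSet a ∩ Ioo β₀ β₁) ≤ s := by
  have hγ0 : 1 < γ := by linarith
  have hb0 : 0 < β₀ := by linarith
  have hc0 : 0 < 1 - β₁/γ := by
    have := (div_lt_one (by linarith : 0 < γ)).2 h1
    linarith
  set c := 1 - β₁/γ with hc
  set ρ : ℝ := β₀ ^ (-(1 + a)) with hρ
  have hρ0 : 0 < ρ := by positivity
  have hρ1 : ρ < 1 := Real.rpow_lt_one_of_one_lt_of_neg h0 (by linarith)
  refine dimH_le_of_limsup_cover (fun n => ⌊γ ^ n / c⌋₊ + 1) (fun n => β₀ * ρ ^ n)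
    (fun n => by positivity) ?_ ?_
    (fun n i => {β | β ∈ Ioo β₀ β₁ ∧ wcode c γ n β = i ∧ 1 ≤ n ∧
      ∀ j : ℕ, (j : ℝ) < a * n → epsDig β (n + j) = 0}) ?_ ?_ ?_
  · intro m n hmn
    exact mul_le_mul_of_nonneg_left (pow_le_pow_of_le_one hρ0.le hρ1.le hmn) hb0.le
  · simpa using (tendsto_pow_atTop_nhds_zero_of_lt_one hρ0.le hρ1).const_mul β₀
  · intro n i
    refine Metric.ediam_le fun β hβ β' hβ' => ?_
    obtain ⟨hI, hw, hn, hz⟩ := hβ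
    obtain ⟨hI', hw', -, hz'⟩ := hβ'
    rw [edist_dist]
    refine ENNReal.ofReal_le_ofReal ?_
    have hd := wcode_inj (h0.trans hI.1) (h0.trans hI'.1) hI.2 hI'.2 h1 n (hw.trans hw'.symm)
    have hL := Nat.le_ceil (a * n)
    set L := ⌈a * n⌉₊ with hLd
    have hall : ∀ i < (n + L - 1) + 1, epsDig β i = epsDig β' i := by
      intro i hi
      rcases lt_or_ge i n with h | h
      · exact hd i h
      · obtain ⟨j, rfl⟩ := Nat.exists_eq_add_of_le h
        have hj : (j : ℝ) < a * n := Nat.lt_ceil.1 (by omega)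
        rw [hz j hj, hz' j hj]
    refine (cyl_dist h0 hI.1 hI'.1 _ hall).trans ?_
    have e1 : (β₀ ^ (n + L - 1))⁻¹ = β₀ * β₀ ^ (-((n:ℝ) + L)) := by
      have : β₀ ^ (n + L) = β₀ ^ (n + L - 1) * β₀ := by
        rw [← pow_succ]; congr 1; omega
      rw [Real.rpow_neg hb0.le, ← Nat.cast_add, Real.rpow_natCast, this]
      field_simp
    rw [e1, hρ, ← Real.rpow_mul_natCast hb0.le]
    gcongr
    · exact h0.le
    · nlinarith
  · rintro β ⟨⟨hβ, hf⟩, hI⟩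
    refine (hf.and_eventually (eventually_ge_atTop 1)).mono ?_
    rintro n ⟨hz, hn⟩
    exact ⟨⟨wcode c γ n β, wcode_lt (h0.trans hI.1) hI.2 h1 n⟩, hI, rfl, hn, hz⟩
  · have hq : γ * ρ ^ (s : ℝ) < 1 := by
      have : ρ ^ (s : ℝ) = (β₀ ^ ((1 + a) * s))⁻¹ := by
        rw [hρ, ← Real.rpow_mul hb0.le, ← Real.rpow_neg hb0.le]; congr 1; ring
      rw [this, ← div_eq_mul_inv, div_lt_one (by positivity)]
      exact hγ
    have hq0 : 0 ≤ γ * ρ ^ (s : ℝ) := by positivity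
    have hsum := (summable_geometric_of_lt_one hq0 hq).mul_left ((1 / c + 1) * β₀ ^ (s:ℝ))
    refine Summable.of_nonneg_of_le (fun n => by positivity) (fun n => ?_) hsum
    have hfl : ((⌊γ ^ n / c⌋₊ + 1 : ℕ) : ℝ) ≤ (1 / c + 1) * γ ^ n := by
      push_cast
      have := Nat.floor_le (a := γ ^ n / c) (by positivity)
      have h2 : 1 ≤ γ ^ n := one_le_pow₀ hγ0.le
      have : (1 / c + 1) * γ ^ n = γ ^ n / c + γ ^ n := by ring
      linarith
    have e2 : (β₀ * ρ ^ n) ^ (s : ℝ) = β₀ ^ (s:ℝ) * (ρ ^ (s:ℝ)) ^ n := by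
      rw [Real.mul_rpow hb0.le (by positivity), ← Real.rpow_natCast, ← Real.rpow_mul hρ0.le,
        mul_comm (n:ℝ), Real.rpow_mul hρ0.le, Real.rpow_natCast]
    rw [e2, mul_pow]
    calc _ ≤ (1 / c + 1) * γ ^ n * (β₀ ^ (s:ℝ) * (ρ ^ (s:ℝ)) ^ n) := by gcongr
      _ = _ := by ring

lemma dimH_zeroRunSet_le {a : ℝ} (ha : 0 < a) {s : ℝ≥0} (hs : 1 < (1 + a) * s) :
    dimH (zeroRunSet a) ≤ s := by
  by_contra! hc
  obtain ⟨x, hx, hn⟩ := exists_mem_nhdsWithin_lt_dimH_of_lt_dimH hc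
  have hx1 : 1 < x := hx.1
  set κ : ℝ := (1 + a) * s with hκ
  have hκ0 : 0 < κ := by linarith
  have h1 : x < x ^ κ := by
    simpa using Real.rpow_lt_rpow_of_exponent_lt hx1 hs
  obtain ⟨γ, hγ1, hγ2⟩ := exists_between h1
  have h2 : γ ^ (κ⁻¹) < x := by
    have := Real.rpow_lt_rpow (by linarith) hγ2 (inv_pos.2 hκ0)
    rwa [← Real.rpow_mul (by linarith), mul_inv_cancel₀ hκ0.ne', Real.rpow_one] at this
  obtain ⟨β₀, hb, hb'⟩ := exists_between (max_lt hx1 h2)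
  obtain ⟨β₁, hc1, hc2⟩ := exists_between hγ1
  have hb0 : 1 < β₀ := (le_max_left _ _).trans_lt hb
  have h3 : γ < β₀ ^ κ := by
    have := Real.rpow_lt_rpow (Real.rpow_nonneg (by linarith) _) ((le_max_right _ _).trans_lt hb) hκ0
    rwa [← Real.rpow_mul (by linarith), inv_mul_cancel₀ hκ0.ne', Real.rpow_one] at this
  have h4 := dimH_local ha hb0 hc2 (hb'.trans hc1) h3
  exact absurd h4 (not_le.2 (hn _ (inter_mem self_mem_nhdsWithin
    (mem_nhdsWithin_of_mem_nhds (Ioo_mem_nhds hb' hc1)))))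

lemma F_subset_zeroRunSet {α a : ℝ} (ha : 0 < a) (haα : a < α) :
    {β : ℝ | 1 < β ∧ ENNReal.ofReal α ≤
        limsup (fun n : ℕ => (runLenStar β n : ℝ≥0∞) / (n : ℝ≥0∞)) atTop} ⊆ zeroRunSet a := by
  rintro β ⟨hβ, hl⟩
  refine ⟨hβ, ?_⟩
  by_cases h : ∃ m, epsDig β m ≠ 0 ∧ ∀ i, m < i → epsDig β i = 0
  · obtain ⟨m, -, hm⟩ := h
    refine Eventually.frequently ?_
    filter_upwards [eventually_gt_atTop m] with n hn j _
    exact hm _ (by omega)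
  · have he : epsStar β = epsDig β := by unfold epsStar; rw [dif_neg h]
    have hlt : ENNReal.ofReal a < limsup (fun n : ℕ => (runLenStar β n : ℝ≥0∞) / (n : ℝ≥0∞)) atTop :=
      ((ENNReal.ofReal_lt_ofReal_iff (ha.trans haα)).2 haα).trans_le hl
    have hf := frequently_lt_of_lt_limsup (h := hlt)
    refine (hf.and_eventually (eventually_ge_atTop 1)).mono ?_
    rintro n ⟨hn, hn1⟩ j hj
    have hn0 : (0:ℝ) < n := by exact_mod_cast hn1
    have h5 : a * n < runLenStar β n := by
      have e : (runLenStar β n : ℝ≥0∞) / (n : ℝ≥0∞) = ENNReal.ofReal ((runLenStar β n : ℝ) / n) := by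
        rw [ENNReal.ofReal_div_of_pos hn0, ENNReal.ofReal_natCast, ENNReal.ofReal_natCast]
      rw [e] at hn
      have := (ENNReal.ofReal_lt_ofReal_iff_of_nonneg ha.le).1 hn
      rwa [lt_div_iff₀ hn0] at this
    have hpos : runLenStar β n ≠ 0 := by
      intro h0
      rw [h0] at h5
      have : 0 < a * n := by positivity
      norm_num at h5; linarith
    have hmem : runLenStar β n ∈ {k | ∀ j < k, epsStar β (n + j) = 0} := by
      refine Nat.sSup_mem ⟨0, by simp⟩ ?_
      by_contra hb
      exact hpos (by unfold runLenStar; rw [csSup_of_not_bddAbove hb]; simp)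
    rw [← he]
    refine hmem j ?_
    have : (j:ℝ) < runLenStar β n := hj.trans h5
    exact_mod_cast this

lemma upper_bound (α : ℝ) (hα : 0 < α) :
    dimH {β : ℝ | 1 < β ∧ ENNReal.ofReal α ≤
        limsup (fun n : ℕ => (runLenStar β n : ℝ≥0∞) / (n : ℝ≥0∞)) atTop} ≤
      ENNReal.ofReal (1 / (1 + α)) := by
  refine le_of_forall_gt_imp_ge_of_dense fun t ht => ?_
  obtain ⟨s, hs1, hs2⟩ := ENNReal.lt_iff_exists_nnreal_btwn.1 ht
  refine le_trans ?_ hs2.le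
  have h1 : 1 / (1 + α) < s := by
    rw [← ENNReal.ofReal_coe_nnreal] at hs1
    exact (ENNReal.ofReal_lt_ofReal_iff_of_nonneg (by positivity)).1 hs1
  have hs0 : (0:ℝ) < s := lt_trans (by positivity) h1
  have h2 : 1 / s - 1 < α := by
    rw [div_lt_iff₀ (by positivity)] at h1
    have : 1 / (s:ℝ) < 1 + α := by rw [div_lt_iff₀ hs0]; linarith
    linarith
  obtain ⟨a, ha1, ha2⟩ := exists_between (max_lt hα h2)
  have ha0 : 0 < a := (le_max_left _ _).trans_lt ha1
  have h3 : 1 / (s:ℝ) < 1 + a := by linarith [(le_max_right _ _).trans_lt ha1]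
  rw [div_lt_iff₀ hs0] at h3
  exact (dimH_mono (F_subset_zeroRunSet ha0 ha2)).trans (dimH_zeroRunSet_le ha0 h3)

/-! ### Lower bound: existence of a parameter with prescribed digits -/

/-- Tails of the series attached to a digit sequence. -/
noncomputable def tailSum (w : ℕ → ℕ) (k : ℕ) (β : ℝ) : ℝ :=
  ∑' i, (w (k + i) : ℝ) * (β⁻¹) ^ (i + 1)

lemma tailTerm_le {b : ℕ} {w : ℕ → ℕ} (hw : ∀ i, w i ≤ b + 1) {β : ℝ}
    (hβ : (b:ℝ) + 1 ≤ β) (k i : ℕ) :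
    (w (k + i) : ℝ) * (β⁻¹) ^ (i + 1) ≤ ((b:ℝ) + 1) * (((b:ℝ)+1)⁻¹) ^ (i+1) := by
  have h1 : (w (k+i) : ℝ) ≤ b + 1 := by exact_mod_cast hw _
  have h0 : (0:ℝ) < (b:ℝ) + 1 := by positivity
  have hβ0 : 0 < β := by linarith
  gcongr

lemma tailSum_summable_maj {b : ℕ} (hb : 2 ≤ b) :
    Summable fun i : ℕ => ((b:ℝ) + 1) * (((b:ℝ)+1)⁻¹) ^ (i+1) := by
  have : (2:ℝ) ≤ b := by exact_mod_cast hb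
  refine Summable.mul_left _ ((summable_nat_add_iff 1).2
    (summable_geometric_of_lt_one (by positivity) (inv_lt_one_of_one_lt₀ (by linarith))))

lemma tailSum_summable {b : ℕ} (hb : 2 ≤ b) {w : ℕ → ℕ} (hw : ∀ i, w i ≤ b + 1) {β : ℝ}
    (hβ : (b:ℝ) + 1 ≤ β) (k : ℕ) : Summable fun i => (w (k + i) : ℝ) * (β⁻¹) ^ (i + 1) := by
  have hβ0 : 0 < β := lt_of_lt_of_le (by positivity) hβ
  exact Summable.of_nonneg_of_le (fun i => by positivity) (tailTerm_le hw hβ k)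
    (tailSum_summable_maj hb)

lemma tailSum_rec {b : ℕ} (hb : 2 ≤ b) {w : ℕ → ℕ} (hw : ∀ i, w i ≤ b + 1) {β : ℝ}
    (hβ : (b:ℝ) + 1 ≤ β) (k : ℕ) : β * tailSum w k β = w k + tailSum w (k+1) β := by
  have hβ0 : 0 < β := lt_of_lt_of_le (by positivity) hβ
  unfold tailSum
  rw [(tailSum_summable hb hw hβ k).tsum_eq_zero_add, mul_add, ← tsum_mul_left]
  congr 1
  · simp; field_simp
  · congr 1; funext i
    rw [show k + 1 + i = k + (i+1) by ring, pow_succ _ (i+1)]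
    field_simp

lemma tailSum_nonneg {w : ℕ → ℕ} {β : ℝ} (hβ : 0 ≤ β) (k : ℕ) : 0 ≤ tailSum w k β :=
  tsum_nonneg fun i => by positivity

lemma tailSum_lt_one {b : ℕ} (hb : 2 ≤ b) {w : ℕ → ℕ} (hw0 : w 0 = b + 1)
    (hw : ∀ i, 1 ≤ i → w i + 1 ≤ b) {β : ℝ} (hβ : (b:ℝ) + 1 ≤ β) (k : ℕ) (hk : 1 ≤ k) :
    tailSum w k β < 1 := by
  have hb2 : (2:ℝ) ≤ b := by exact_mod_cast hb
  have hβ0 : 0 < β := by linarith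
  have hw' : ∀ i, w i ≤ b + 1 := by
    intro i
    rcases Nat.eq_zero_or_pos i with rfl | h
    · omega
    · have := hw i h; omega
  have hi : β⁻¹ < 1 := inv_lt_one_of_one_lt₀ (by linarith)
  have hs : HasSum (fun i : ℕ => ((b:ℝ) - 1) * (β⁻¹) * (β⁻¹) ^ i)
      (((b:ℝ) - 1) * (β⁻¹) * (1 - β⁻¹)⁻¹) :=
    (hasSum_geometric_of_lt_one (by positivity) hi).mul_left _
  have hle : tailSum w k β ≤ ((b:ℝ) - 1) * (β⁻¹) * (1 - β⁻¹)⁻¹ := by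
    rw [← hs.tsum_eq]
    refine (tailSum_summable hb hw' hβ k).tsum_le_tsum (fun i => ?_) hs.summable
    have : (w (k+i) : ℝ) + 1 ≤ b := by exact_mod_cast hw (k+i) (by omega)
    rw [pow_succ', ← mul_assoc]
    gcongr
    linarith
  refine hle.trans_lt ?_
  have e : ((b:ℝ) - 1) * (β⁻¹) * (1 - β⁻¹)⁻¹ = ((b:ℝ) - 1) / (β - 1) := by
    have : β - 1 ≠ 0 := by linarith
    have h3 : 1 - β⁻¹ ≠ 0 := by linarith
    field_simp
  rw [e, div_lt_one (by linarith)]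
  linarith

lemma exists_beta {b : ℕ} (hb : 2 ≤ b) {w : ℕ → ℕ} (hw0 : w 0 = b + 1)
    (hw : ∀ i, 1 ≤ i → w i + 1 ≤ b) :
    ∃ β : ℝ, (b:ℝ) + 1 ≤ β ∧ β ≤ (b:ℝ) + 2 ∧ ∀ i, epsDig β i = w i := by
  have hb2 : (2:ℝ) ≤ b := by exact_mod_cast hb
  have hw' : ∀ i, w i ≤ b + 1 := by
    intro i
    rcases Nat.eq_zero_or_pos i with rfl | h
    · omega
    · have := hw i h; omega
  have hcont : ContinuousOn (tailSum w 0) (Icc ((b:ℝ)+1) ((b:ℝ)+2)) := by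
    refine continuousOn_tsum (fun i => ?_) (tailSum_summable_maj hb) (fun i β hβ => ?_)
    · refine continuousOn_const.mul (ContinuousOn.pow (continuousOn_id.inv₀ ?_) _)
      intro β hβ
      have : (b:ℝ)+1 ≤ β := hβ.1
      simp only [id]; linarith
    · have : 0 ≤ β := by linarith [hβ.1]
      rw [Real.norm_of_nonneg (by positivity)]
      exact tailTerm_le hw' hβ.1 0 i
  have hiv := intermediate_value_Icc' (by linarith) hcont
  have hmem : (1:ℝ) ∈ Icc (tailSum w 0 ((b:ℝ)+2)) (tailSum w 0 ((b:ℝ)+1)) := by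
    constructor
    · have h1 := tailSum_rec hb hw' (β := (b:ℝ)+2) (by linarith) 0
      have h2 := tailSum_lt_one hb hw0 hw (β := (b:ℝ)+2) (by linarith) 1 le_rfl
      rw [hw0] at h1
      push_cast at h1
      nlinarith
    · have h1 := tailSum_rec hb hw' (β := (b:ℝ)+1) le_rfl 0
      have h2 := tailSum_nonneg (w := w) (β := (b:ℝ)+1) (by linarith) 1
      rw [hw0] at h1
      push_cast at h1
      nlinarith
  obtain ⟨β, ⟨hβ1, hβ2⟩, hβ⟩ := hiv hmem
  refine ⟨β, hβ1, hβ2, ?_⟩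
  have key : ∀ i, ⌊β * tailSum w i β⌋ = w i := by
    intro i
    rw [tailSum_rec hb hw' hβ1 i, Int.floor_eq_iff]
    have h1 := tailSum_nonneg (w := w) (β := β) (by linarith) (i+1)
    have h2 := tailSum_lt_one hb hw0 hw hβ1 (i+1) (by omega)
    constructor
    · push_cast; linarith
    · push_cast; linarith
  have hx : ∀ i, (betaT β)^[i] 1 = tailSum w i β := by
    intro i
    induction i with
    | zero => simp [hβ]
    | succ i ih =>
      rw [Function.iterate_succ_apply', ih]
      simp only [betaT]
      rw [key i, tailSum_rec hb hw' hβ1 i]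
      push_cast; ring
  intro i
  unfold epsDig
  rw [hx i, key i]
  simp

/-! ### Lower bound: separation -/

lemma orbit_diff {β β' B : ℝ} (hβ : 1 < β) (hβ' : 1 < β') (hB : 2 ≤ B) (hb1 : β ≤ B) (p : ℕ)
    (h : ∀ i < p, epsDig β i = epsDig β' i) :
    |(betaT β)^[p] 1 - (betaT β')^[p] 1| ≤ |β - β'| * (B ^ p - 1) := by
  induction p with
  | zero => simp
  | succ p ih =>
    have ih := ih (fun i hi => h i (by omega))
    have h1 := bx_rec hβ p
    have h2 := bx_rec hβ' p
    rw [h p (by omega)] at h1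
    have e : (betaT β)^[p+1] 1 - (betaT β')^[p+1] 1 =
        β * ((betaT β)^[p] 1 - (betaT β')^[p] 1) + (β - β') * (betaT β')^[p] 1 := by linarith
    rw [e]
    refine (abs_add_le _ _).trans ?_
    rw [abs_mul, abs_mul, abs_of_pos (by linarith : 0 < β), abs_of_nonneg (bx_nonneg β' p)]
    have h3 := bx_le_one β' p
    have h4 := abs_nonneg (β - β')
    have h5 := abs_nonneg ((betaT β)^[p] 1 - (betaT β')^[p] 1)
    calc β * |(betaT β)^[p] 1 - (betaT β')^[p] 1| + |β - β'| * (betaT β')^[p] 1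
        ≤ B * (|β - β'| * (B ^ p - 1)) + |β - β'| * 1 := by gcongr
      _ ≤ _ := by rw [pow_succ]; nlinarith

lemma beta_sep {b : ℕ} {β β' : ℝ} (hβ : (b:ℝ) + 1 ≤ β) (hβ' : (b:ℝ) + 1 ≤ β')
    (h2 : β ≤ (b:ℝ) + 2) (hb : 2 ≤ b) (h2' : β' ≤ (b:ℝ) + 2)
    (hw : ∀ i, 1 ≤ i → epsDig β i + 1 ≤ b) (hw' : ∀ i, 1 ≤ i → epsDig β' i + 1 ≤ b) (p : ℕ)
    (h : ∀ i < p, epsDig β i = epsDig β' i) (hne : epsDig β p ≠ epsDig β' p) :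
    (((b:ℝ) + 2) ^ (p + 2))⁻¹ ≤ |β - β'| := by
  wlog hlt : epsDig β' p < epsDig β p generalizing β β'
  · rw [abs_sub_comm]
    exact this hβ' hβ h2' h2 hw' hw (fun i hi => (h i hi).symm) hne.symm (by omega)
  have hb2 : (2:ℝ) ≤ b := by exact_mod_cast hb
  have hd := orbit_diff (B := (b:ℝ)+2) (by linarith : 1 < β) (by linarith : 1 < β')
    (by linarith) h2 p h
  have r1 := bx_rec (by linarith : 1 < β) p
  have r2 := bx_rec (by linarith : 1 < β') p
  have r3 := bx_rec (by linarith : 1 < β') (p+1)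
  have w1 : (epsDig β' (p+1) : ℝ) + 1 ≤ b := by exact_mod_cast hw' (p+1) (by omega)
  have l1 := bx_le_one β' (p+1+1)
  have n1 := bx_nonneg β (p+1)
  have n2 := bx_nonneg β' (p+1)
  have d1 : (epsDig β' p : ℝ) + 1 ≤ epsDig β p := by exact_mod_cast hlt
  set B : ℝ := (b:ℝ) + 2 with hB
  have hy : 1 / B ≤ 1 - (betaT β')^[p+1] 1 := by
    rw [div_le_iff₀ (by positivity)]
    nlinarith
  have up : β * (betaT β)^[p] 1 - β' * (betaT β')^[p] 1 ≤ |β - β'| * B ^ (p+1) := by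
    have e : β * (betaT β)^[p] 1 - β' * (betaT β')^[p] 1 =
        β * ((betaT β)^[p] 1 - (betaT β')^[p] 1) + (β - β') * (betaT β')^[p] 1 := by ring
    rw [e]
    refine (le_abs_self _).trans ((abs_add_le _ _).trans ?_)
    rw [abs_mul, abs_mul, abs_of_pos (by linarith : 0 < β), abs_of_nonneg (bx_nonneg β' p)]
    have h3 := bx_le_one β' p
    have h4 := abs_nonneg (β - β')
    calc β * |(betaT β)^[p] 1 - (betaT β')^[p] 1| + |β - β'| * (betaT β')^[p] 1
        ≤ B * (|β - β'| * (B ^ p - 1)) + |β - β'| * 1 := by gcongr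
      _ ≤ _ := by rw [pow_succ]; nlinarith
  have fin : 1 / B ≤ |β - β'| * B ^ (p+1) := by linarith
  rw [div_le_iff₀ (by positivity), mul_assoc, ← pow_succ] at fin
  rw [← one_div, div_le_iff₀ (by positivity)]
  exact fin

/-! ### Lower bound: the pattern of zero runs -/

open Classical in
lemma count_add_le (P : ℕ → Prop) (m d : ℕ) (h : ∀ q, m ≤ q → q < m + d → P q) :
    Nat.count P m + d ≤ Nat.count P (m + d) := by
  induction d with
  | zero => simp
  | succ d ih =>
    have ih := ih (fun q h1 h2 => h q h1 (by omega))
    rw [← add_assoc, ← add_assoc, Nat.count_succ, if_pos (h (m+d) (by omega) (by omega))]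
    omega

open Classical in
lemma exists_count_eq (P : ℕ → Prop) (p i : ℕ) (hi : i < Nat.count P p) :
    ∃ q < p, P q ∧ Nat.count P q = i := by
  induction p with
  | zero => simp at hi
  | succ p ih =>
    rw [Nat.count_succ] at hi
    by_cases h : i < Nat.count P p
    · obtain ⟨q, hq, h1⟩ := ih h
      exact ⟨q, by omega, h1⟩
    · by_cases hp : P p
      · rw [if_pos hp] at hi
        exact ⟨p, by omega, hp, by omega⟩
      · rw [if_neg hp] at hi; omega

/-- Free positions: neither the first one nor inside a forced block. -/
def freePos (n L : ℕ → ℕ) (p : ℕ) : Prop := p ≠ 0 ∧ ¬ ∃ k, n k ≤ p ∧ p ≤ n k + L k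

open Classical in
lemma exists_pattern {α θ : ℝ} (hα : 0 < α) (hθ0 : 0 < θ) (hθ : θ * (1 + α) < 1) :
    ∃ n L : ℕ → ℕ, StrictMono n ∧ (∀ k, 1 ≤ n k) ∧ (∀ k, α * n k ≤ L k) ∧
      (∀ k, n k + L k < n (k+1)) ∧
      (∀ p, freePos n L p → θ * p ≤ Nat.count (freePos n L) p + 1) ∧
      (∀ N, ∃ p, N ≤ Nat.count (freePos n L) p) := by
  obtain ⟨δ, hδ⟩ : ∃ δ, δ = (1 - θ * (1 + α)) / 2 := ⟨_, rfl⟩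
  have hδ0 : 0 < δ := by rw [hδ]; linarith
  have hθ1 : θ < 1 := by nlinarith
  have hδ1 : δ < 1 / 2 := by rw [hδ]; nlinarith
  obtain ⟨K, hK⟩ := exists_nat_gt ((α + 3) / δ)
  have hK' : α + 3 < δ * K := by rw [div_lt_iff₀ hδ0] at hK; linarith
  have hK2 : 2 ≤ K := by
    have : (2:ℝ) < K := by nlinarith
    exact_mod_cast this.le
  obtain ⟨n, hn⟩ : ∃ n : ℕ → ℕ, n = fun k => K ^ (k + 1) := ⟨_, rfl⟩
  obtain ⟨L, hL⟩ : ∃ L : ℕ → ℕ, L = fun k => ⌈α * n k⌉₊ := ⟨_, rfl⟩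
  have hnS : ∀ k, n (k+1) = K * n k := by intro k; rw [hn]; simp only; ring
  have hn0 : n 0 = K := by rw [hn]; simp
  have hmono : StrictMono n := by
    rw [hn]; intro i j hij
    exact Nat.pow_lt_pow_right (by omega) (by omega)
  have hnK : ∀ k, K ≤ n k := fun k => hn0 ▸ hmono.monotone (Nat.zero_le k)
  have hnKr : ∀ k, (K:ℝ) ≤ n k := fun k => by exact_mod_cast hnK k
  have hL1 : ∀ k, α * n k ≤ L k := fun k => by rw [hL]; exact Nat.le_ceil _
  have hL2 : ∀ k, (L k : ℝ) < α * n k + 1 := fun k => by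
    rw [hL]; exact Nat.ceil_lt_add_one (by positivity)
  have hK2r : (2:ℝ) ≤ K := by exact_mod_cast hK2
  have hgapr : ∀ k, (n k : ℝ) + L k + 1 ≤ δ * n (k+1) := by
    intro k
    have h1 := hL2 k
    have h2 := hnKr k
    rw [hnS k]; push_cast
    nlinarith
  have hgap : ∀ k, n k + L k < n (k+1) := by
    intro k
    have h1 := hgapr k
    have h2 := hnKr (k+1)
    have : (n k : ℝ) + L k < n (k+1) := by nlinarith
    exact_mod_cast this
  set P := freePos n L with hP
  -- positions between blocks are free
  have hfree : ∀ k q, n k + L k + 1 ≤ q → q < n (k+1) → P q := by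
    rintro k q h1 h2
    refine ⟨by omega, ?_⟩
    rintro ⟨i, hi1, hi2⟩
    rcases lt_trichotomy i k with h | h | h
    · have h3 := hgap i
      have h4 := hmono.monotone (show i + 1 ≤ k from h)
      omega
    · subst h; omega
    · have h4 := hmono.monotone (show k + 1 ≤ i from h)
      omega
  have hfree0 : ∀ q, 1 ≤ q → q < n 0 → P q := by
    rintro q h1 h2
    refine ⟨by omega, ?_⟩
    rintro ⟨i, hi1, hi2⟩
    have h4 := hmono.monotone (Nat.zero_le i)
    omega
  have hc0 : ∀ p, 1 ≤ p → p ≤ n 0 → p ≤ Nat.count P p + 1 := by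
    intro p h1 h2
    have := count_add_le P 1 (p - 1) (fun q a c => hfree0 q a (by omega))
    rw [show 1 + (p - 1) = p by omega] at this
    omega
  have hck : ∀ k p, n k + L k + 1 ≤ p → p ≤ n (k+1) →
      Nat.count P (n k) + p ≤ Nat.count P p + (n k + L k + 1) := by
    intro k p h1 h2
    have := count_add_le P (n k + L k + 1) (p - (n k + L k + 1))
      (fun q a c => hfree k q a (by omega))
    rw [show n k + L k + 1 + (p - (n k + L k + 1)) = p by omega] at this
    have h3 := Nat.count_monotone P (show n k ≤ n k + L k + 1 by omega)
    omega
  have hcn : ∀ k, (1 - δ) * n k ≤ Nat.count P (n k) := by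
    intro k
    cases k with
    | zero =>
      have h1 := hc0 (n 0) (by rw [hn0]; omega) le_rfl
      have h2 : (n 0 : ℝ) ≤ Nat.count P (n 0) + 1 := by exact_mod_cast h1
      have h3 := hnKr 0
      nlinarith
    | succ k =>
      have h1 := hck k (n (k+1)) (by have := hgap k; omega) le_rfl
      have h2 : (Nat.count P (n k) : ℝ) + n (k+1) ≤ Nat.count P (n (k+1)) + (n k + L k + 1) := by
        exact_mod_cast h1
      have h3 := hgapr k
      have h4 : (0:ℝ) ≤ Nat.count P (n k) := by positivity
      linarith
  refine ⟨n, L, hmono, fun k => by have := hnK k; omega, hL1, hgap, ?_, ?_⟩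
  · intro p hp
    by_cases hp0 : p ≤ n 0
    · have h1 := hc0 p (Nat.one_le_iff_ne_zero.2 hp.1) hp0
      have h2 : (p : ℝ) ≤ Nat.count P p + 1 := by exact_mod_cast h1
      have h3 : (0:ℝ) ≤ p := by positivity
      nlinarith
    · have hex : ∃ k, p ≤ n k := ⟨p, hmono.le_apply⟩
      obtain ⟨k, hk1, hk2⟩ : ∃ k, n k < p ∧ p ≤ n (k+1) := by
        have hs := Nat.find_spec hex
        have hm := fun m => Nat.find_min (H := hex) (m := m)
        rcases hf : Nat.find hex with _ | k
        · rw [hf] at hs; exact absurd hs hp0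
        · rw [hf] at hs
          exact ⟨k, not_le.1 (hm k (by omega)), hs⟩
      have hk3 : n k + L k + 1 ≤ p := by
        by_contra hc
        exact hp.2 ⟨k, by omega, by omega⟩
      have h1 := hck k p hk3 hk2
      have h2 : (Nat.count P (n k) : ℝ) + p ≤ Nat.count P p + (n k + L k + 1) := by
        exact_mod_cast h1
      have h3 := hcn k
      have h4 := hL1 k
      have h5 := hL2 k
      have h6 : (n k : ℝ) + L k + 1 ≤ p := by exact_mod_cast hk3
      have h7 := hnKr k
      have h8 : (1 + α) * n k ≤ p := by linarith
      have h9 : (1 - θ) * ((1 + α) * n k) ≤ (1 - θ) * p :=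
        mul_le_mul_of_nonneg_left h8 (by linarith)
      have h10 : (1 - θ) * ((1 + α) * n k) = (α + 2 * δ) * n k := by rw [hδ]; ring
      have h11 : δ * K ≤ δ * n k := mul_le_mul_of_nonneg_left h7 hδ0.le
      nlinarith
  · intro N
    refine ⟨n (2 * N), ?_⟩
    have h1 := hcn (2 * N)
    have h2 : 2 * N ≤ n (2 * N) := hmono.le_apply
    have h3 : (2:ℝ) * N ≤ n (2 * N) := by exact_mod_cast h2
    have : (N : ℝ) ≤ Nat.count P (n (2 * N)) := by nlinarith
    exact_mod_cast this

open Classical in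
/-- The digit sequence attached to free digits `a`. -/
noncomputable def patWord (b : ℕ) (n L : ℕ → ℕ) (a : ℕ → Fin b) (p : ℕ) : ℕ :=
  if p = 0 then b + 1 else if ∃ k, n k ≤ p ∧ p < n k + L k then 0
  else if ∃ k, p = n k + L k then 1 else a (Nat.count (freePos n L) p)

lemma patWord_le {b : ℕ} (hb : 2 ≤ b) (n L : ℕ → ℕ) (a : ℕ → Fin b) (p : ℕ) (hp : 1 ≤ p) :
    patWord b n L a p + 1 ≤ b := by
  unfold patWord
  rw [if_neg (by omega)]
  split_ifs
  · omega
  · omega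
  · exact (a _).2

open Classical in
lemma patWord_free {b : ℕ} {n L : ℕ → ℕ} (a : ℕ → Fin b) {p : ℕ} (hp : freePos n L p) :
    patWord b n L a p = a (Nat.count (freePos n L) p) := by
  unfold patWord
  rw [if_neg hp.1, if_neg, if_neg]
  · rintro ⟨k, hk⟩; exact hp.2 ⟨k, by omega, by omega⟩
  · rintro ⟨k, hk⟩; exact hp.2 ⟨k, by omega, by omega⟩

lemma patWord_not_free {b : ℕ} {n L : ℕ → ℕ} (a a' : ℕ → Fin b) {p : ℕ} (hp : ¬ freePos n L p) :
    patWord b n L a p = patWord b n L a' p := by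
  unfold patWord
  split_ifs with h1 h2 h3
  · rfl
  · rfl
  · rfl
  · exfalso; apply hp
    refine ⟨h1, ?_⟩
    rintro ⟨k, hk1, hk2⟩
    rcases Nat.lt_or_ge p (n k + L k) with h | h
    · exact h2 ⟨k, hk1, h⟩
    · exact h3 ⟨k, by omega⟩

lemma patWord_zero {b : ℕ} {n L : ℕ → ℕ} (hn : ∀ k, 1 ≤ n k) (a : ℕ → Fin b) (k j : ℕ)
    (hj : j < L k) : patWord b n L a (n k + j) = 0 := by
  unfold patWord
  have := hn k
  rw [if_neg (by omega), if_pos ⟨k, by omega, by omega⟩]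

lemma patWord_end {b : ℕ} {n L : ℕ → ℕ} (hn : ∀ k, 1 ≤ n k) (hm : StrictMono n)
    (hg : ∀ k, n k + L k < n (k+1)) (a : ℕ → Fin b) (k : ℕ) :
    patWord b n L a (n k + L k) = 1 := by
  unfold patWord
  have := hn k
  rw [if_neg (by omega), if_neg, if_pos ⟨k, rfl⟩]
  rintro ⟨i, hi1, hi2⟩
  rcases lt_trichotomy i k with h | h | h
  · have h3 := hg i
    have h4 := hm.monotone (show i + 1 ≤ k from h)
    omega
  · subst h; omega
  · have h4 := hm.monotone (show k + 1 ≤ i from h)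
    have := hg k
    omega

/-- A parameter with the digits prescribed by the pattern lies in `F(α)`. -/
lemma mem_F_of_digits {b : ℕ} {n L : ℕ → ℕ} {α : ℝ} (hn : ∀ k, 1 ≤ n k) (hm : StrictMono n)
    (hg : ∀ k, n k + L k < n (k+1)) (hL : ∀ k, α * n k ≤ L k)
    (a : ℕ → Fin b) {β : ℝ} (hβ : 1 < β) (hd : ∀ i, epsDig β i = patWord b n L a i) :
    ENNReal.ofReal α ≤
        limsup (fun n : ℕ => (runLenStar β n : ℝ≥0∞) / (n : ℝ≥0∞)) atTop := by
  have hinf : ¬ ∃ m, epsDig β m ≠ 0 ∧ ∀ i, m < i → epsDig β i = 0 := by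
    rintro ⟨m, -, h⟩
    have h1 : m + 1 ≤ n (m+1) := hm.le_apply
    have h2 := h (n (m+1) + L (m+1)) (by omega)
    rw [hd, patWord_end hn hm hg] at h2
    omega
  have he : epsStar β = epsDig β := by unfold epsStar; rw [dif_neg hinf]
  refine le_limsup_of_frequently_le' ?_
  rw [frequently_atTop]
  intro N
  refine ⟨n N, hm.le_apply, ?_⟩
  have hle : L N ≤ runLenStar β (n N) := by
    unfold runLenStar
    refine le_csSup ⟨L N, ?_⟩ ?_
    · intro k hk
      by_contra hc
      have := hk (L N) (by omega)
      rw [he, hd, patWord_end hn hm hg] at this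
      omega
    · intro j hj
      rw [he, hd, patWord_zero hn a N j hj]
  have hn0 : (0:ℝ) < n N := by exact_mod_cast hn N
  have e : (runLenStar β (n N) : ℝ≥0∞) / (n N : ℝ≥0∞) =
      ENNReal.ofReal ((runLenStar β (n N) : ℝ) / n N) := by
    rw [ENNReal.ofReal_div_of_pos hn0, ENNReal.ofReal_natCast, ENNReal.ofReal_natCast]
  rw [e]
  refine ENNReal.ofReal_le_ofReal ?_
  rw [le_div_iff₀ hn0]
  have : (L N : ℝ) ≤ runLenStar β (n N) := by exact_mod_cast hle
  exact (hL N).trans this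

lemma lower_aux {α θ : ℝ} (hα : 0 < α) (hθ0 : 0 < θ) (hθ : θ * (1 + α) < 1) {b : ℕ} (hb : 2 ≤ b)
    {t : ℝ≥0} (ht : 0 < t) (hbt : ((b:ℝ) + 2) ^ (t:ℝ) ≤ (b:ℝ) ^ θ) :
    (t : ℝ≥0∞) ≤ dimH {β : ℝ | 1 < β ∧ ENNReal.ofReal α ≤
        limsup (fun n : ℕ => (runLenStar β n : ℝ≥0∞) / (n : ℝ≥0∞)) atTop} := by
  classical
  obtain ⟨n, L, hm, hn, hL, hg, hcount, hunb⟩ := exists_pattern hα hθ0 hθ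
  have hb2 : (2:ℝ) ≤ b := by exact_mod_cast hb
  have hex : ∀ a : ℕ → Fin b, ∃ β : ℝ, (b:ℝ) + 1 ≤ β ∧ β ≤ (b:ℝ) + 2 ∧
      ∀ i, epsDig β i = patWord b n L a i := fun a =>
    exists_beta hb (by simp [patWord]) (fun i hi => patWord_le hb n L a i hi)
  choose g hg1 hg2 hgd using hex
  set B : ℝ := (b:ℝ) + 2 with hB
  have hB0 : 0 < B := by positivity
  have hb0 : (0:ℝ) < b := by linarith
  set C : ℝ := b * B ^ (2 * (t:ℝ)) with hC
  have hC0 : 0 ≤ C := by positivity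
  have key : ∀ a a' : ℕ → Fin b,
      |Real.ofDigits a - Real.ofDigits a'| ≤ C * |g a - g a'| ^ (t:ℝ) := by
    intro a a'
    by_cases hne : ∃ p, patWord b n L a p ≠ patWord b n L a' p
    · have hs := Nat.find_spec hne
      have hmin : ∀ i < Nat.find hne, patWord b n L a i = patWord b n L a' i :=
        fun i hi => not_not.1 (Nat.find_min hne hi)
      set p := Nat.find hne
      have hpf : freePos n L p := by
        by_contra hc; exact hs (patWord_not_free a a' hc)
      have hagree : ∀ i < Nat.count (freePos n L) p, a i = a' i := by
        intro i hi
        obtain ⟨q, hq, hqf, rfl⟩ := exists_count_eq _ p i hi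
        have := hmin q hq
        rw [patWord_free a hqf, patWord_free a' hqf] at this
        exact Fin.ext this
      have h1 := Real.abs_ofDigits_sub_ofDigits_le hagree
      have h2 := beta_sep (hg1 a) (hg1 a') (hg2 a) hb (hg2 a')
        (fun i hi => by rw [hgd]; exact patWord_le hb n L a i hi)
        (fun i hi => by rw [hgd]; exact patWord_le hb n L a' i hi) p
        (fun i hi => by rw [hgd, hgd]; exact hmin i hi) (by rw [hgd, hgd]; exact hs)
      have h3 := hcount p hpf
      set j := Nat.count (freePos n L) p
      refine h1.trans ?_
      have h4 : ((B ^ (p + 2))⁻¹) ^ (t:ℝ) ≤ |g a - g a'| ^ (t:ℝ) :=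
        Real.rpow_le_rpow (by positivity) h2 t.coe_nonneg
      refine le_trans ?_ (mul_le_mul_of_nonneg_left h4 hC0)
      have e1 : ((B ^ (p + 2))⁻¹) ^ (t:ℝ) = ((B ^ (t:ℝ)) ^ p)⁻¹ * (B ^ (2 * (t:ℝ)))⁻¹ := by
        rw [Real.inv_rpow (by positivity), ← mul_inv]
        congr 1
        rw [← Real.rpow_natCast, ← Real.rpow_natCast, ← Real.rpow_mul hB0.le,
          ← Real.rpow_mul hB0.le, ← Real.rpow_add hB0]
        congr 1; push_cast; ring
      have e2 : C * ((B ^ (p + 2))⁻¹) ^ (t:ℝ) = b * ((B ^ (t:ℝ)) ^ p)⁻¹ := by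
        rw [e1, hC]
        have : B ^ (2 * (t:ℝ)) ≠ 0 := by positivity
        field_simp
      rw [e2]
      have e3 : (((b:ℝ) ^ θ) ^ p)⁻¹ ≤ ((B ^ (t:ℝ)) ^ p)⁻¹ := by
        gcongr
      refine le_trans ?_ (mul_le_mul_of_nonneg_left e3 hb0.le)
      have e4 : (b:ℝ) * (((b:ℝ) ^ θ) ^ p)⁻¹ = (b:ℝ) ^ (1 - θ * p) := by
        rw [Real.rpow_sub hb0, Real.rpow_one, Real.rpow_mul_natCast hb0.le, div_eq_mul_inv]
      have e5 : ((b:ℝ) ^ j)⁻¹ = (b:ℝ) ^ (-(j:ℝ)) := by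
        rw [Real.rpow_neg hb0.le, Real.rpow_natCast]
      rw [e4, e5]
      exact Real.rpow_le_rpow_of_exponent_le (by linarith) (by linarith)
    · push Not at hne
      have : a = a' := by
        funext i
        obtain ⟨p, hp⟩ := hunb (i+1)
        obtain ⟨q, hq, hqf, rfl⟩ := exists_count_eq (freePos n L) p i (by omega)
        have := hne q
        rw [patWord_free a hqf, patWord_free a' hqf] at this
        exact Fin.ext this
      subst this
      simp only [sub_self, abs_zero]
      positivity
  haveI : Nonempty (ℕ → Fin b) := ⟨fun _ => ⟨0, by omega⟩⟩
  set f : ℝ → ℝ := fun β => Real.ofDigits (Function.invFun g β) with hf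
  have hinv : ∀ a, g (Function.invFun g (g a)) = g a := fun a => Function.invFun_eq ⟨a, rfl⟩
  have hH : HolderOnWith C.toNNReal t f (range g) := by
    rintro _ ⟨a, rfl⟩ _ ⟨a', rfl⟩
    have := key (Function.invFun g (g a)) (Function.invFun g (g a'))
    rw [hinv, hinv] at this
    rw [edist_dist, edist_dist, ENNReal.ofReal_rpow_of_nonneg dist_nonneg t.coe_nonneg,
      show ((C.toNNReal : ℝ≥0) : ℝ≥0∞) = ENNReal.ofReal C from rfl, ← ENNReal.ofReal_mul hC0]
    exact ENNReal.ofReal_le_ofReal this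
  have hsurj : Icc (0:ℝ) 1 ⊆ f '' range g := by
    intro y hy
    obtain ⟨a, -, rfl⟩ := Real.ofDigits_SurjOn (show 1 < b by omega) hy
    refine ⟨g a, ⟨a, rfl⟩, ?_⟩
    have := key (Function.invFun g (g a)) a
    rw [hinv, sub_self, abs_zero, Real.zero_rpow (by exact_mod_cast ht.ne'), mul_zero] at this
    exact sub_eq_zero.1 (abs_eq_zero.1 (le_antisymm this (abs_nonneg _)))
  have hdim1 : dimH (Icc (0:ℝ) 1) = 1 := by
    rw [Real.dimH_of_nonempty_interior (by rw [interior_Icc]; exact ⟨1/2, by norm_num⟩)]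
    simp
  have h1 : (1 : ℝ≥0∞) ≤ dimH (range g) / t :=
    hdim1.symm.le.trans ((dimH_mono hsurj).trans (hH.dimH_image_le ht))
  have h2 : (t : ℝ≥0∞) ≤ dimH (range g) := by
    have := (ENNReal.le_div_iff_mul_le (Or.inl (by exact_mod_cast ht.ne'))
      (Or.inl ENNReal.coe_ne_top)).1 h1
    simpa using this
  refine h2.trans (dimH_mono ?_)
  rintro _ ⟨a, rfl⟩
  have h3 : 1 < g a := by linarith [hg1 a]
  exact ⟨h3, mem_F_of_digits hn hm hg hL a h3 (hgd a)⟩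

lemma lower_bound (α : ℝ) (hα : 0 < α) :
    ENNReal.ofReal (1 / (1 + α)) ≤ dimH {β : ℝ | 1 < β ∧ ENNReal.ofReal α ≤
        limsup (fun n : ℕ => (runLenStar β n : ℝ≥0∞) / (n : ℝ≥0∞)) atTop} := by
  refine le_of_forall_lt fun u hu => ?_
  obtain ⟨t, ht1, ht2⟩ := ENNReal.lt_iff_exists_nnreal_btwn.1 hu
  refine ht1.trans_le ?_
  have ht0 : 0 < t := by
    have := (zero_le (a := u)).trans_lt ht1
    exact_mod_cast this
  have h1 : (t:ℝ) < 1 / (1 + α) := by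
    rw [← ENNReal.ofReal_coe_nnreal] at ht2
    exact (ENNReal.ofReal_lt_ofReal_iff_of_nonneg t.coe_nonneg).1 ht2
  obtain ⟨θ, hθ1, hθ2⟩ := exists_between h1
  have ht0' : (0:ℝ) < t := by exact_mod_cast ht0
  have hθ0 : 0 < θ := ht0'.trans hθ1
  rw [lt_div_iff₀ (by positivity)] at hθ2
  -- choose a large base
  have hlim : Tendsto (fun b : ℕ => (θ - t) * Real.log b) atTop atTop :=
    (Real.tendsto_log_atTop.comp tendsto_natCast_atTop_atTop).const_mul_atTop (by linarith)
  obtain ⟨b, hb1, hb2⟩ := ((hlim.eventually_ge_atTop ((t:ℝ) * Real.log 2)).and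
    (eventually_ge_atTop 2)).exists
  have hb2r : (2:ℝ) ≤ b := by exact_mod_cast hb2
  refine lower_aux hα hθ0 hθ2 hb2 ht0 ?_
  have h3 : ((b:ℝ) + 2) ^ (t:ℝ) ≤ (2 * b) ^ (t:ℝ) :=
    Real.rpow_le_rpow (by positivity) (by linarith) ht0'.le
  refine h3.trans ?_
  rw [← Real.log_le_log_iff (by positivity) (by positivity), Real.log_rpow (by positivity),
    Real.log_rpow (by positivity), Real.log_mul (by norm_num) (by positivity)]
  linarith

/-- Proposition 8.2, inner claim. For every real `α > 0`, the set
`F(α) = {β > 1 : limsup ℓ_n(β)/n ≥ α}` has Hausdorff dimension `1/(1+α)`. -/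
theorem dimH_F_alpha (α : ℝ) (hα : 0 < α) :
    dimH {β : ℝ | 1 < β ∧ ENNReal.ofReal α ≤
        limsup (fun n : ℕ => (runLenStar β n : ℝ≥0∞) / (n : ℝ≥0∞)) atTop} =
      ENNReal.ofReal (1 / (1 + α)) := by
  exact le_antisymm (upper_bound α hα) (lower_bound α hα)
end

section
/- The set A_2 = {β > 1 : limsup_{n→∞} ℓ_n(β)/n > 0} has Lebesgue measure zero and Hausdorff dimension 1. -/
open Filter MeasureTheory Set
open scoped ENNReal

/-! ### Basic facts on the orbit of 1 -/

/-- The orbit of 1. -/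
noncomputable def orb (β : ℝ) (n : ℕ) : ℝ := (betaT β)^[n] 1

lemma orb_zero (β : ℝ) : orb β 0 = 1 := rfl

lemma orb_succ' (β : ℝ) (n : ℕ) : orb β (n + 1) = Int.fract (β * orb β n) := by
  unfold orb
  rw [Function.iterate_succ_apply']
  rfl

lemma orb_nonneg (β : ℝ) (n : ℕ) : 0 ≤ orb β n := by
  cases n with
  | zero => rw [orb_zero]; norm_num
  | succ n => rw [orb_succ']; exact Int.fract_nonneg _

lemma orb_lt_one (β : ℝ) (n : ℕ) : orb β (n + 1) < 1 := by
  rw [orb_succ']; exact Int.fract_lt_one _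

lemma orb_le_one (β : ℝ) (n : ℕ) : orb β n ≤ 1 := by
  cases n with
  | zero => rw [orb_zero]
  | succ n => exact (orb_lt_one β n).le

lemma epsDig_cast {β : ℝ} (hβ : 0 ≤ β) (n : ℕ) :
    (epsDig β n : ℝ) = (⌊β * orb β n⌋ : ℝ) := by
  have h : (0 : ℤ) ≤ ⌊β * orb β n⌋ := Int.floor_nonneg.2 (mul_nonneg hβ (orb_nonneg β n))
  have h2 : ((epsDig β n : ℕ) : ℤ) = ⌊β * orb β n⌋ := Int.toNat_of_nonneg h
  exact_mod_cast congrArg (fun z : ℤ => (z : ℝ)) h2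

lemma orb_succ {β : ℝ} (hβ : 0 ≤ β) (n : ℕ) :
    orb β (n + 1) = β * orb β n - epsDig β n := by
  rw [orb_succ', epsDig_cast hβ]
  rfl

/-! ### Counting words -/

/-- The value of a finite word in base `b`. -/
noncomputable def wval (b : ℝ) : List ℕ → ℝ
  | [] => 0
  | d :: w => (d + wval b w) / b

/-- The words of length `n` all of whose tails have value `< 1`. -/
noncomputable def wset (b : ℝ) : ℕ → Finset (List ℕ)
  | 0 => {[]}
  | n + 1 => (wset b n).biUnion fun w =>
      (Finset.range ⌈b - wval b w⌉₊).image (fun d => d :: w)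

open Classical in
/-- Truncated Parry density. -/
noncomputable def parryH (b : ℝ) (K : ℕ) (x : ℝ) : ℝ :=
  ∑ k ∈ Finset.range (K + 1), (b⁻¹) ^ k * (if x < orb b k then 1 else 0)

lemma wval_nonneg {b : ℝ} (hb : 0 < b) (w : List ℕ) : 0 ≤ wval b w := by
  induction w with
  | nil => simp [wval]
  | cons d w ih => simp only [wval]; positivity

lemma wval_lt_one {b : ℝ} (hb : 0 < b) (n : ℕ) (w : List ℕ) (hw : w ∈ wset b n) :
    wval b w < 1 := by
  cases n with
  | zero => simp [wset] at hw; simp [hw, wval]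
  | succ n =>
    simp only [wset, Finset.mem_biUnion, Finset.mem_image, Finset.mem_range] at hw
    obtain ⟨v, hv, d, hd, rfl⟩ := hw
    rw [Nat.lt_ceil] at hd
    simp only [wval]
    rw [div_lt_one hb]
    linarith

open Classical in
lemma count_aux {b : ℝ} (hb : 0 < b) (k R : ℕ) (x : ℝ) (hx : 0 ≤ x) :
    ∑ d ∈ Finset.range R, (if ((d : ℝ) + x) / b < orb b k then (1 : ℝ) else 0)
      ≤ epsDig b k + (if x < orb b (k + 1) then 1 else 0) := by
  have key : ∀ d : ℕ, ((d : ℝ) + x) / b < orb b k →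
      (d < epsDig b k ∨ (d = epsDig b k ∧ x < orb b (k + 1))) := by
    intro d hd
    rw [div_lt_iff₀ hb] at hd
    have h1 := orb_succ hb.le k
    have h2 := orb_lt_one b k
    rcases lt_trichotomy d (epsDig b k) with h | h | h
    · exact Or.inl h
    · refine Or.inr ⟨h, ?_⟩
      rw [h] at hd
      linarith
    · exfalso
      have : (epsDig b k : ℝ) + 1 ≤ d := by exact_mod_cast h
      linarith
  rw [← Finset.sum_filter, Finset.sum_const, nsmul_eq_mul, mul_one]
  by_cases hxo : x < orb b (k + 1)
  · rw [if_pos hxo]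
    have : (Finset.range R).filter (fun d : ℕ => ((d : ℝ) + x) / b < orb b k)
        ⊆ Finset.range (epsDig b k + 1) := by
      intro d hd
      rw [Finset.mem_filter] at hd
      rw [Finset.mem_range]
      rcases key d hd.2 with h | h <;> omega
    have := Finset.card_le_card this
    rw [Finset.card_range] at this
    exact_mod_cast this
  · rw [if_neg hxo, add_zero]
    have : (Finset.range R).filter (fun d : ℕ => ((d : ℝ) + x) / b < orb b k)
        ⊆ Finset.range (epsDig b k) := by
      intro d hd
      rw [Finset.mem_filter] at hd
      rw [Finset.mem_range]
      rcases key d hd.2 with h | h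
      · exact h
      · exact absurd h.2 hxo
    have := Finset.card_le_card this
    rw [Finset.card_range] at this
    exact_mod_cast this

lemma sum_eps {b : ℝ} (hb : 0 < b) (K : ℕ) :
    ∑ k ∈ Finset.range K, (b⁻¹) ^ k * (epsDig b k : ℝ) = b - b * (b⁻¹) ^ K * orb b K := by
  induction K with
  | zero => simp [orb_zero]
  | succ K ih =>
    rw [Finset.sum_range_succ, ih, orb_succ hb.le, pow_succ]
    field_simp
    ring

lemma parryH_step {b : ℝ} (hb : 0 < b) (K R : ℕ) (x : ℝ) (hx : 0 ≤ x) (hx1 : x < 1) :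
    ∑ d ∈ Finset.range R, parryH b K (((d : ℝ) + x) / b) ≤ b * parryH b (K + 1) x := by
  classical
  unfold parryH
  rw [Finset.sum_comm, Finset.sum_range_succ' _ (K + 1), orb_zero, if_pos hx1]
  have h1 : ∀ k ∈ Finset.range (K + 1),
      ∑ d ∈ Finset.range R, (b⁻¹) ^ k * (if ((d : ℝ) + x) / b < orb b k then (1 : ℝ) else 0)
      ≤ (b⁻¹) ^ k * epsDig b k + b * ((b⁻¹) ^ (k + 1) * (if x < orb b (k + 1) then 1 else 0)) := by
    intro k _
    rw [← Finset.mul_sum]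
    have h2 := count_aux hb k R x hx
    have h3 : b * ((b⁻¹) ^ (k + 1) * (if x < orb b (k + 1) then (1 : ℝ) else 0))
        = (b⁻¹) ^ k * (if x < orb b (k + 1) then 1 else 0) := by
      rw [pow_succ]; field_simp
    rw [h3, ← mul_add]
    exact mul_le_mul_of_nonneg_left h2 (by positivity)
  refine (Finset.sum_le_sum h1).trans ?_
  rw [Finset.sum_add_distrib, sum_eps hb, ← Finset.mul_sum]
  have h4 : 0 ≤ b * (b⁻¹) ^ (K + 1) * orb b (K + 1) := by
    have := orb_nonneg b (K + 1); positivity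
  simp only [pow_zero, mul_one]
  linarith

lemma parry_sum {b : ℝ} (hb : 0 < b) (n : ℕ) : ∀ K : ℕ,
    ∑ w ∈ wset b n, parryH b K (wval b w) ≤ b ^ n * parryH b (K + n) 0 := by
  induction n with
  | zero => intro K; simp [wset, wval]
  | succ n ih =>
    intro K
    have h0 : ∀ x, 0 ≤ parryH b K x := by
      intro x
      unfold parryH
      exact Finset.sum_nonneg fun k _ => by positivity
    have h1 : ∑ w ∈ wset b (n + 1), parryH b K (wval b w) ≤
        ∑ w ∈ wset b n, ∑ d ∈ Finset.range ⌈b - wval b w⌉₊,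
          parryH b K (((d : ℝ) + wval b w) / b) := by
      simp only [wset]
      rw [Finset.sum_biUnion]
      swap
      · intro u _ v _ huv
        rw [Function.onFun, Finset.disjoint_left]
        intro l hl hl'
        rw [Finset.mem_image] at hl hl'
        obtain ⟨d, _, rfl⟩ := hl
        obtain ⟨e, _, he⟩ := hl'
        simp only [List.cons.injEq] at he
        exact huv he.2.symm
      refine Finset.sum_le_sum fun w _ => ?_
      rw [Finset.sum_image]
      · simp [wval]
      · intro a _ c _ h
        simpa using h
    refine h1.trans ?_
    have h2 : ∀ w ∈ wset b n, ∑ d ∈ Finset.range ⌈b - wval b w⌉₊,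
          parryH b K (((d : ℝ) + wval b w) / b) ≤ b * parryH b (K + 1) (wval b w) :=
      fun w hw => parryH_step hb K _ _ (wval_nonneg hb w) (wval_lt_one hb n w hw)
    refine (Finset.sum_le_sum h2).trans ?_
    rw [← Finset.mul_sum, pow_succ']
    have := mul_le_mul_of_nonneg_left (ih (K + 1)) hb.le
    rw [show K + (n + 1) = K + 1 + n by ring, mul_assoc]
    exact this

lemma card_wset {b : ℝ} (hb : 1 ≤ b) (n : ℕ) : ((wset b n).card : ℝ) ≤ b ^ n * (n + 1) := by
  have hb0 : 0 < b := by linarith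
  have h1 := parry_sum hb0 n 0
  have h2 : ∀ w ∈ wset b n, parryH b 0 (wval b w) = 1 := by
    intro w hw
    simp [parryH, orb_zero, wval_lt_one hb0 n w hw]
  rw [Finset.sum_congr rfl h2, Finset.sum_const, nsmul_eq_mul, mul_one] at h1
  refine h1.trans (mul_le_mul_of_nonneg_left ?_ (by positivity))
  unfold parryH
  have h3 : ∀ k ∈ Finset.range (0 + n + 1),
      (b⁻¹) ^ k * (if 0 < orb b k then (1 : ℝ) else 0) ≤ 1 := by
    intro k _
    have : (b⁻¹) ^ k ≤ 1 := pow_le_one₀ (by positivity) (inv_le_one_of_one_le₀ hb)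
    split_ifs <;> linarith
  refine (Finset.sum_le_sum h3).trans ?_
  simp

/-! ### Words of parameters -/

/-- The word of digits of length `n` starting from index `i`. -/
noncomputable def dword (β : ℝ) : ℕ → ℕ → List ℕ
  | _, 0 => []
  | i, n + 1 => epsDig β i :: dword β (i + 1) n

lemma dword_inj {β γ : ℝ} (n : ℕ) : ∀ i, dword β i n = dword γ i n →
    ∀ j < n, epsDig β (i + j) = epsDig γ (i + j) := by
  induction n with
  | zero => intro i _ j hj; omega
  | succ n ih =>
    intro i h j hj
    simp only [dword, List.cons.injEq] at h
    cases j with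
    | zero => exact h.1
    | succ j =>
      have := ih (i + 1) h.2 j (by omega)
      rwa [show i + (j + 1) = i + 1 + j by ring]

lemma dword_mem {β b : ℝ} (hβ : 0 < β) (hb : β < b) (n : ℕ) : ∀ i,
    dword β i n ∈ wset b n ∧ wval b (dword β i n) ≤ orb β i := by
  have hb0 : 0 < b := hβ.trans hb
  induction n with
  | zero => intro i; simp [dword, wset, wval, orb_nonneg]
  | succ n ih =>
    intro i
    obtain ⟨h1, h2⟩ := ih (i + 1)
    have h3 := orb_succ hβ.le i
    have h4 := orb_le_one β i
    have h5 := orb_nonneg β i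
    have h6 : β * orb β i ≤ β := by nlinarith
    constructor
    · simp only [dword, wset, Finset.mem_biUnion, Finset.mem_image, Finset.mem_range]
      refine ⟨_, h1, _, ?_, rfl⟩
      rw [Nat.lt_ceil]
      linarith
    · simp only [dword, wval]
      rw [div_le_iff₀ hb0]
      have : orb β i * β ≤ orb β i * b := mul_le_mul_of_nonneg_left hb.le h5
      linarith

lemma orb_diff_lower {c β γ : ℝ} (hc : 0 < c) (h1 : c ≤ β) (h2 : β ≤ γ) (n : ℕ)
    (h : ∀ i < n + 1, epsDig β i = epsDig γ i) :
    c ^ n * (γ - β) ≤ orb γ (n + 1) - orb β (n + 1) := by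
  induction n with
  | zero =>
    rw [orb_succ (by linarith), orb_succ (by linarith), h 0 (by omega), orb_zero, orb_zero]
    linarith
  | succ n ih =>
    have ih' := ih fun i hi => h i (by omega)
    rw [orb_succ (by linarith) (n + 1), orb_succ (by linarith) (n + 1), h (n + 1) (by omega)]
    have h3 := orb_nonneg β (n + 1)
    have h4 : 0 ≤ c ^ n * (γ - β) := mul_nonneg (by positivity) (by linarith)
    have h5 : c * (c ^ n * (γ - β)) ≤ γ * (orb γ (n + 1) - orb β (n + 1)) :=
      mul_le_mul (by linarith) ih' h4 (by linarith)
    have h6 : 0 ≤ (γ - β) * orb β (n + 1) := mul_nonneg (by linarith) h3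
    rw [pow_succ']
    linarith

lemma vol_small {b c t : ℝ} (hc : 1 < c) (hcb : c < b) (n : ℕ) :
    volume {β : ℝ | β ∈ Ioo c b ∧ orb β (n + 1) ≤ t} ≤
      ENNReal.ofReal (b ^ (n + 1) * (n + 2) * (t / c ^ n)) := by
  have hc0 : 0 < c := by linarith
  have hsub : {β : ℝ | β ∈ Ioo c b ∧ orb β (n + 1) ≤ t} ⊆
      ⋃ w ∈ wset b (n + 1), {β : ℝ | β ∈ Ioo c b ∧ orb β (n + 1) ≤ t ∧ dword β 0 (n + 1) = w} := by
    intro β hβ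
    simp only [mem_iUnion]
    exact ⟨_, (dword_mem (by linarith [hβ.1.1]) hβ.1.2 (n + 1) 0).1, hβ.1, hβ.2, rfl⟩
  refine (measure_mono hsub).trans ((measure_biUnion_finset_le _ _).trans ?_)
  have hpc : ∀ w ∈ wset b (n + 1),
      volume {β : ℝ | β ∈ Ioo c b ∧ orb β (n + 1) ≤ t ∧ dword β 0 (n + 1) = w}
        ≤ ENNReal.ofReal (t / c ^ n) := by
    intro w _
    refine (Real.volume_le_diam _).trans ?_
    refine Metric.ediam_le ?_
    have main : ∀ x y : ℝ, x ≤ y → x ∈ Ioo c b → orb y (n + 1) ≤ t →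
        dword x 0 (n + 1) = dword y 0 (n + 1) → y - x ≤ t / c ^ n := by
      intro x y hxy hx hy he
      have h1 := orb_diff_lower hc0 hx.1.le hxy n (fun i hi => by
        have := dword_inj (n + 1) 0 he i hi
        simpa using this)
      rw [le_div_iff₀ (by positivity)]
      have := orb_nonneg x (n + 1)
      linarith
    rintro x ⟨hx1, hx2, hx3⟩ y ⟨hy1, hy2, hy3⟩
    rw [edist_dist]
    refine ENNReal.ofReal_le_ofReal ?_
    rw [Real.dist_eq]
    rcases le_total x y with hxy | hxy
    · rw [abs_sub_comm, abs_of_nonneg (by linarith)]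
      exact main x y hxy hx1 hy2 (hx3.trans hy3.symm)
    · rw [abs_of_nonneg (by linarith)]
      exact main y x hxy hy1 hx2 (hy3.trans hx3.symm)
  refine (Finset.sum_le_sum hpc).trans ?_
  rw [Finset.sum_const, nsmul_eq_mul]
  have hcard := card_wset (b := b) (by linarith) (n + 1)
  have : ((wset b (n + 1)).card : ℝ≥0∞) ≤ ENNReal.ofReal (b ^ (n + 1) * (n + 2)) := by
    rw [← ENNReal.ofReal_natCast]
    refine ENNReal.ofReal_le_ofReal (hcard.trans (le_of_eq ?_))
    push_cast; ring
  rw [ENNReal.ofReal_mul (by have : 0 < b := by linarith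
                             positivity)]
  gcongr

/-! ### The measure zero part -/

lemma orb_run {β : ℝ} (hβ : 0 ≤ β) (n L : ℕ) (h : ∀ j < L, epsDig β (n + j) = 0) :
    orb β n * β ^ L = orb β (n + L) := by
  induction L with
  | zero => simp
  | succ L ih =>
    have h1 := ih fun j hj => h j (by omega)
    rw [← add_assoc, orb_succ hβ, h L (by omega), pow_succ, ← mul_assoc, h1]
    simp [mul_comm]

/-- Parameters with long runs of zeros infinitely often. -/
def runSet (m : ℕ) : Set ℝ :=
  {β | 1 < β ∧ ∃ᶠ n : ℕ in atTop, ∃ L : ℕ, n ≤ m * L ∧ ∀ j < L, epsDig β (n + j) = 0}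

lemma runSet_loc {m : ℕ} {b c s : ℝ} (hc : 1 < c) (hcb : c < b) (hs : 1 < s)
    (hsm : s ^ m = c) (hb : b < c * s) : volume (runSet m ∩ Ioo c b) = 0 := by
  have hc0 : 0 < c := by linarith
  have hb0 : 0 < b := by linarith
  have hs0 : 0 < s := by linarith
  let A : ℕ → Set ℝ := fun n => {β : ℝ | β ∈ Ioo c b ∧ orb β (n + 1) ≤ 1 / s ^ (n + 1)}
  have hsub : runSet m ∩ Ioo c b ⊆ {β | ∃ᶠ n in atTop, β ∈ A n} := by
    rintro β ⟨⟨hβ, hfr⟩, hI⟩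
    have hfr2 := hfr.and_eventually (eventually_ge_atTop 1)
    rw [Set.mem_ofPred_eq, Filter.frequently_atTop]
    intro N
    obtain ⟨n, hn, ⟨L, hL, hz⟩, hn1⟩ := Filter.frequently_atTop.1 hfr2 (N + 1)
    refine ⟨n - 1, by omega, hI, ?_⟩
    rw [Nat.sub_add_cancel hn1, le_div_iff₀ (by positivity)]
    have h1 := orb_run (by linarith) n L hz
    have h2 := orb_le_one β (n + L)
    have h3 : s ^ n ≤ β ^ L := by
      calc s ^ n ≤ s ^ (m * L) := pow_le_pow_right₀ hs.le hL
        _ = c ^ L := by rw [pow_mul, hsm]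
        _ ≤ β ^ L := pow_le_pow_left₀ hc0.le hI.1.le L
    have h4 := mul_le_mul_of_nonneg_left h3 (orb_nonneg β n)
    linarith
  refine measure_mono_null hsub (measure_setOfPred_frequently_eq_zero ?_)
  have hbd : ∀ n, volume (A n) ≤ ENNReal.ofReal (b / s * ((n + 2) * (b / (c * s)) ^ n)) := by
    intro n
    refine (vol_small hc hcb n).trans (ENNReal.ofReal_le_ofReal (le_of_eq ?_))
    rw [div_pow, mul_pow, pow_succ, pow_succ]
    field_simp
  have hr0 : 0 ≤ b / (c * s) := by positivity
  have hr1 : b / (c * s) < 1 := by rw [div_lt_one (by positivity)]; exact hb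
  have hsum : Summable fun n : ℕ => b / s * (((n : ℝ) + 2) * (b / (c * s)) ^ n) := by
    refine Summable.mul_left _ ?_
    have e1 := summable_pow_mul_geometric_of_norm_lt_one 1 (r := b / (c * s))
      (by rw [Real.norm_of_nonneg hr0]; exact hr1)
    have e2 := (summable_geometric_of_lt_one hr0 hr1).mul_left 2
    refine (e1.add e2).congr fun n => ?_
    ring
  have := hsum.tsum_ofReal_ne_top
  exact ne_top_of_le_ne_top this (ENNReal.tsum_le_tsum hbd)

lemma runSet_null (m : ℕ) (hm : 0 < m) : volume (runSet m) = 0 := by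
  refine measure_null_of_locally_null _ fun β hβ => ?_
  have h1 : 1 < β := hβ.1
  have hm' : (0 : ℝ) < 1 / m := by positivity
  have hcont : ContinuousAt (fun c : ℝ => c * c ^ (1 / m : ℝ)) β :=
    continuousAt_id.mul (Real.continuousAt_rpow_const _ _ (Or.inl (by positivity)))
  have hgt : β < β * β ^ (1 / m : ℝ) := by
    have := Real.one_lt_rpow h1 hm'
    nlinarith
  have hev : ∀ᶠ c in nhdsWithin β (Iio β), β < c * c ^ (1 / m : ℝ) :=
    (hcont.eventually (lt_mem_nhds hgt)).filter_mono nhdsWithin_le_nhds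
  have hev2 : ∀ᶠ c in nhdsWithin β (Iio β), 1 < c :=
    (lt_mem_nhds h1).filter_mono nhdsWithin_le_nhds
  obtain ⟨c, ⟨hc1, hc2⟩, hc3⟩ := ((hev.and hev2).and self_mem_nhdsWithin).exists
  obtain ⟨b, hb1, hb2⟩ := exists_between hc1
  refine ⟨runSet m ∩ Ioo c b, inter_mem_nhdsWithin _ (Ioo_mem_nhds hc3 hb1), ?_⟩
  refine runSet_loc hc2 (lt_trans hc3 hb1) (Real.one_lt_rpow hc2 hm') ?_ hb2
  rw [← Real.rpow_natCast, ← Real.rpow_mul (by linarith), one_div, inv_mul_cancel₀ (by positivity),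
    Real.rpow_one]

lemma A2_null : volume {β : ℝ | 1 < β ∧
        0 < limsup (fun n : ℕ => (runLenStar β n : ℝ≥0∞) / (n : ℝ≥0∞)) atTop} = 0 := by
  have hsub : {β : ℝ | 1 < β ∧
        0 < limsup (fun n : ℕ => (runLenStar β n : ℝ≥0∞) / (n : ℝ≥0∞)) atTop} ⊆
      ⋃ m : ℕ, runSet (m + 1) := by
    rintro β ⟨hβ, hlim⟩
    rw [mem_iUnion]
    by_cases h : ∃ m, epsDig β m ≠ 0 ∧ ∀ i, m < i → epsDig β i = 0
    · obtain ⟨k, _, hk⟩ := h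
      refine ⟨0, hβ, ?_⟩
      refine Filter.Eventually.frequently ?_
      filter_upwards [eventually_gt_atTop k] with n hn
      exact ⟨n, by omega, fun j _ => hk _ (by omega)⟩
    · have hstar : epsStar β = epsDig β := by
        unfold epsStar; rw [dif_neg h]
      obtain ⟨δ, hδ0, hδ⟩ := exists_between hlim
      obtain ⟨m, hm⟩ := ENNReal.exists_inv_nat_lt hδ0.ne'
      have hfr := frequently_lt_of_lt_limsup (by isBoundedDefault) hδ
      refine ⟨m, hβ, ?_⟩
      refine hfr.mono fun n hn => ?_
      refine ⟨runLenStar β n, ?_, ?_⟩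
      · by_contra hcon
        push Not at hcon
        have h1 : (runLenStar β n : ℝ≥0∞) / n ≤ (m : ℝ≥0∞)⁻¹ := by
          have hm0 : m ≠ 0 := by
            rintro rfl
            simp at hm
          refine ENNReal.div_le_of_le_mul ?_
          rw [mul_comm, ← div_eq_mul_inv, ENNReal.le_div_iff_mul_le (by simp [hm0]) (by simp)]
          have : runLenStar β n * m ≤ n := by nlinarith
          exact_mod_cast this
        exact absurd (hm.trans hn) (not_lt.2 h1)
      · have hpos : runLenStar β n ≠ 0 := by
          intro h0
          rw [h0] at hn
          simp at hn
        have hbdd : BddAbove {k | ∀ j < k, epsStar β (n + j) = 0} := by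
          by_contra hb
          exact hpos (Nat.sSup_of_not_bddAbove hb)
        have := Nat.sSup_mem (s := {k | ∀ j < k, epsStar β (n + j) = 0}) ⟨0, by simp⟩ hbdd
        intro j hj
        rw [← hstar]
        exact this j hj
  exact measure_mono_null hsub (measure_iUnion_null fun m => runSet_null _ (by omega))

/-! ### The dimension part: digit sequences -/

/-- Free positions. -/
def fpos (j k : ℕ) : ℕ := 1 + k + 2 ^ (Nat.log 2 k) / 2 ^ j

lemma fpos_strictMono (j : ℕ) : StrictMono (fpos j) := by
  intro k l h
  unfold fpos
  have h1 : 2 ^ (Nat.log 2 k) ≤ 2 ^ (Nat.log 2 l) :=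
    Nat.pow_le_pow_right (by norm_num) (Nat.log_mono_right h.le)
  have h2 := Nat.div_le_div_right (c := 2 ^ j) h1
  omega

lemma lt_fpos (j k : ℕ) : k < fpos j k := by
  unfold fpos
  have := Nat.zero_le (2 ^ (Nat.log 2 k) / 2 ^ j)
  generalize 2 ^ (Nat.log 2 k) / 2 ^ j = z at *
  omega

open Classical in
/-- The digit sequence attached to free digits `d`. -/
noncomputable def aseq (N j : ℕ) (d : ℕ → Fin N) (n : ℕ) : ℕ :=
  if n = 0 then N + 2 else if h : ∃ k, fpos j k = n then (d h.choose : ℕ) + 1 else 0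

lemma aseq_zero (N j : ℕ) (d : ℕ → Fin N) : aseq N j d 0 = N + 2 := by simp [aseq]

lemma aseq_pos (N j : ℕ) (d : ℕ → Fin N) (k : ℕ) : aseq N j d (fpos j k) = d k + 1 := by
  have h0 : fpos j k ≠ 0 := by have := lt_fpos j k; omega
  have h : ∃ l, fpos j l = fpos j k := ⟨k, rfl⟩
  have hc : h.choose = k := (fpos_strictMono j).injective h.choose_spec
  unfold aseq
  rw [if_neg h0, dif_pos h, hc]

lemma aseq_not (N j : ℕ) (d : ℕ → Fin N) (n : ℕ) (hn : n ≠ 0) (h : ¬ ∃ k, fpos j k = n) :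
    aseq N j d n = 0 := by
  unfold aseq
  rw [if_neg hn, dif_neg h]

lemma aseq_le (N j : ℕ) (d : ℕ → Fin N) (n : ℕ) : aseq N j d (n + 1) ≤ N := by
  by_cases h : ∃ k, fpos j k = n + 1
  · obtain ⟨k, hk⟩ := h
    rw [← hk, aseq_pos]
    exact (d k).isLt
  · rw [aseq_not N j d _ (by omega) h]
    omega

lemma exists_param (N : ℕ) (a : ℕ → ℕ) (ha0 : a 0 = N + 2) (ha : ∀ n, a (n + 1) ≤ N) :
    ∃ β ∈ Icc ((N : ℝ) + 2) (N + 3), ∀ i, epsDig β i = a i ∧ orb β (i + 1) ≤ N / (N + 1) := by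
  let F : ℕ → ℝ → ℝ := fun i β => ∑' k, (a (i + k) : ℝ) * (β⁻¹) ^ (k + 1)
  have hN : (0 : ℝ) ≤ N := Nat.cast_nonneg N
  have hale : ∀ n, (a n : ℝ) ≤ N + 2 := by
    intro n
    cases n with
    | zero => rw [ha0]; push_cast; rfl
    | succ n => have : (a (n + 1) : ℝ) ≤ N := by exact_mod_cast ha n
                linarith
  have hgeo : ∀ {x : ℝ}, (N : ℝ) + 2 ≤ x → 0 < x⁻¹ ∧ x⁻¹ ≤ 1 / 2 := by
    intro x hx
    refine ⟨by rw [inv_pos]; linarith, ?_⟩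
    rw [one_div]
    exact inv_anti₀ (by norm_num) (by linarith)
  have hsu : Summable fun k : ℕ => ((N : ℝ) + 2) * (1 / 2 : ℝ) ^ (k + 1) := by
    refine Summable.mul_left _ ?_
    simp only [pow_succ]
    exact (summable_geometric_of_lt_one (by norm_num) (by norm_num)).mul_right _
  have hterm : ∀ i k (x : ℝ), (N : ℝ) + 2 ≤ x →
      ‖(a (i + k) : ℝ) * (x⁻¹) ^ (k + 1)‖ ≤ ((N : ℝ) + 2) * (1 / 2 : ℝ) ^ (k + 1) := by
    intro i k x hx
    obtain ⟨h1, h2⟩ := hgeo hx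
    rw [Real.norm_of_nonneg (by positivity)]
    exact mul_le_mul (hale _) (pow_le_pow_left₀ h1.le h2 _) (by positivity) (by positivity)
  have hsum : ∀ i (x : ℝ), (N : ℝ) + 2 ≤ x →
      Summable fun k : ℕ => (a (i + k) : ℝ) * (x⁻¹) ^ (k + 1) := by
    intro i x hx
    exact Summable.of_norm_bounded hsu fun k => hterm i k x hx
  have hrec : ∀ i (x : ℝ), (N : ℝ) + 2 ≤ x → x * F i x = a i + F (i + 1) x := by
    intro i x hx
    have hx0 : x ≠ 0 := by linarith
    simp only [F]
    rw [(hsum i x hx).tsum_eq_zero_add, mul_add, ← tsum_mul_left]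
    congr 1
    · simp; field_simp
    · refine tsum_congr fun k => ?_
      rw [show i + (k + 1) = i + 1 + k by ring, pow_succ _ (k + 1)]
      field_simp
  have hnn : ∀ i (x : ℝ), (N : ℝ) + 2 ≤ x → 0 ≤ F i x := by
    intro i x hx
    obtain ⟨h1, _⟩ := hgeo hx
    exact tsum_nonneg fun k => by positivity
  have hup : ∀ i (x : ℝ), (N : ℝ) + 2 ≤ x → F (i + 1) x ≤ N / (N + 1) := by
    intro i x hx
    obtain ⟨h1, h2⟩ := hgeo hx
    have hg := (hasSum_geometric_of_lt_one h1.le (by linarith)).mul_left ((N : ℝ) * x⁻¹)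
    have hle : F (i + 1) x ≤ (N : ℝ) * x⁻¹ * (1 - x⁻¹)⁻¹ := by
      rw [← hg.tsum_eq]
      refine (hsum (i + 1) x hx).tsum_le_tsum (fun k => ?_) hg.summable
      have hk : (a (i + 1 + k) : ℝ) ≤ N := by
        rw [show i + 1 + k = i + k + 1 by ring]
        exact_mod_cast ha (i + k)
      rw [pow_succ', ← mul_assoc]
      gcongr
    refine hle.trans ?_
    have hx1 : 0 < x - 1 := by linarith
    have hx0 : 0 < x := by linarith
    have : (N : ℝ) * x⁻¹ * (1 - x⁻¹)⁻¹ = N / (x - 1) := by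
      rw [show (1 - x⁻¹) = (x - 1) / x by field_simp]
      field_simp
    rw [this]
    exact div_le_div_of_nonneg_left hN (by linarith) (by linarith)
  have hcont : ContinuousOn (F 0) (Icc ((N : ℝ) + 2) (N + 3)) := by
    refine continuousOn_tsum (u := fun k : ℕ => ((N : ℝ) + 2) * (1 / 2 : ℝ) ^ (k + 1)) ?_ hsu ?_
    · intro k
      refine continuousOn_const.mul (ContinuousOn.pow ?_ _)
      exact continuousOn_id.inv₀ fun x hx => by
        have := hx.1
        simp only [id]
        linarith
    · intro k x hx
      exact hterm 0 k x hx.1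
  have hlast : (N : ℝ) / (N + 1) < 1 := by
    rw [div_lt_one (by positivity)]; linarith
  have hl : 1 ≤ F 0 ((N : ℝ) + 2) := by
    have h1 := hrec 0 _ (le_refl ((N : ℝ) + 2))
    have h2 := hnn (0 + 1) _ (le_refl ((N : ℝ) + 2))
    rw [ha0] at h1
    push_cast at h1
    nlinarith
  have hr : F 0 ((N : ℝ) + 3) ≤ 1 := by
    have h1 := hrec 0 ((N : ℝ) + 3) (by linarith)
    have h2 := hup 0 ((N : ℝ) + 3) (by linarith)
    rw [ha0] at h1
    push_cast at h1
    nlinarith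
  obtain ⟨β, hβ, hF⟩ := intermediate_value_Icc' (by linarith) hcont ⟨hr, hl⟩
  have hβ0 : 0 ≤ β := by linarith [hβ.1]
  have key : ∀ i, orb β i = F i β → epsDig β i = a i ∧ orb β (i + 1) = F (i + 1) β := by
    intro i hi
    have h1 := hrec i β hβ.1
    have h2 := hnn (i + 1) β hβ.1
    have h3 := hup i β hβ.1
    have h4 : epsDig β i = a i := by
      have h5 : ⌊β * orb β i⌋ = (a i : ℤ) := by
        rw [Int.floor_eq_iff, hi, h1]
        push_cast
        constructor <;> linarith
      change (⌊β * orb β i⌋).toNat = a i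
      rw [h5]; simp
    refine ⟨h4, ?_⟩
    rw [orb_succ hβ0, h4, hi]
    linarith
  have all : ∀ i, orb β i = F i β := by
    intro i
    induction i with
    | zero => rw [orb_zero, hF]
    | succ i ih => exact (key i ih).2
  refine ⟨β, hβ, fun i => ⟨(key i (all i)).1, ?_⟩⟩
  rw [all]
  exact hup i β hβ.1

/-- `β` is the parameter whose digits are given by the free digits `d`. -/
def IsParam (N j : ℕ) (d : ℕ → Fin N) (β : ℝ) : Prop :=
  β ∈ Icc ((N : ℝ) + 2) (N + 3) ∧ ∀ i, epsDig β i = aseq N j d i ∧ orb β (i + 1) ≤ N / (N + 1)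

lemma exists_isParam (N j : ℕ) (d : ℕ → Fin N) : ∃ β, IsParam N j d β := by
  obtain ⟨β, h1, h2⟩ := exists_param N (aseq N j d) (aseq_zero N j d) (aseq_le N j d)
  exact ⟨β, h1, h2⟩

lemma isParam_mem {N j : ℕ} {d : ℕ → Fin N} {β : ℝ} (h : IsParam N j d β) :
    1 < β ∧ 0 < limsup (fun n : ℕ => (runLenStar β n : ℝ≥0∞) / (n : ℝ≥0∞)) atTop := by
  obtain ⟨hI, hd⟩ := h
  have hN : (0 : ℝ) ≤ N := Nat.cast_nonneg N
  refine ⟨by linarith [hI.1], ?_⟩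
  have hinf : ∀ n, ∃ i, n < i ∧ epsDig β i ≠ 0 := by
    intro n
    refine ⟨fpos j n, lt_fpos j n, ?_⟩
    rw [(hd _).1, aseq_pos]
    omega
  have hstar : epsStar β = epsDig β := by
    unfold epsStar
    rw [dif_neg]
    rintro ⟨m, _, hm⟩
    obtain ⟨i, hi, hne⟩ := hinf m
    exact hne (hm i hi)
  have hc : (0 : ℝ≥0∞) < ((2 ^ (j + 3) : ℕ) : ℝ≥0∞)⁻¹ := by
    rw [ENNReal.inv_pos]
    exact ENNReal.natCast_ne_top _
  refine lt_of_lt_of_le hc (le_limsup_of_frequently_le ?_ (by isBoundedDefault))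
  rw [Filter.frequently_atTop]
  intro M
  let t := M
  have ht : M < 2 ^ t := Nat.lt_two_pow_self
  let K := 2 ^ (j + 1 + t)
  have hK1 : 1 ≤ K := Nat.one_le_two_pow
  have hKe : K = 2 * (2 ^ j * 2 ^ t) := by
    simp only [K, pow_add]; ring
  have hj1 : 1 ≤ 2 ^ j := Nat.one_le_two_pow
  have hlogK : Nat.log 2 K = j + 1 + t := Nat.log_pow (by norm_num) _
  have hfK : fpos j K = 1 + K + 2 * 2 ^ t := by
    unfold fpos
    rw [hlogK, show 2 ^ (j + 1 + t) = 2 ^ j * (2 * 2 ^ t) by rw [pow_add, pow_add]; ring,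
      Nat.mul_div_cancel_left _ (by positivity)]
  have hlogK1 : Nat.log 2 (K - 1) = j + t := by
    rw [Nat.log_eq_iff (Or.inr ⟨by norm_num, ?_⟩)]
    · rw [pow_add, pow_succ, pow_add]
      have : 1 ≤ 2 ^ j * 2 ^ t := Nat.one_le_iff_ne_zero.2 (by positivity)
      constructor <;> omega
    · have : 1 ≤ 2 ^ j * 2 ^ t := Nat.one_le_iff_ne_zero.2 (by positivity)
      omega
  have hfK1 : fpos j (K - 1) = K + 2 ^ t := by
    unfold fpos
    rw [hlogK1, pow_add, Nat.mul_div_cancel_left _ (by positivity)]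
    omega
  refine ⟨K + 2 ^ t + 1, by omega, ?_⟩
  have hrun : 2 ^ t ≤ runLenStar β (K + 2 ^ t + 1) := by
    unfold runLenStar
    refine le_csSup ?_ ?_
    · obtain ⟨i, hi, hne⟩ := hinf (K + 2 ^ t + 1)
      refine ⟨i, fun k hk => ?_⟩
      by_contra hcon
      push Not at hcon
      have := hk (i - (K + 2 ^ t + 1)) (by omega)
      rw [hstar, show K + 2 ^ t + 1 + (i - (K + 2 ^ t + 1)) = i by omega] at this
      exact hne this
    · intro i hi
      rw [hstar, (hd _).1]
      refine aseq_not _ _ _ _ (by omega) ?_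
      rintro ⟨k, hk⟩
      have h1 : fpos j k < fpos j K := by omega
      have h2 : fpos j (K - 1) < fpos j k := by omega
      rw [(fpos_strictMono j).lt_iff_lt] at h1 h2
      omega
  rw [ENNReal.le_div_iff_mul_le (Or.inr (by
    have : 0 < 2 ^ t := by positivity
    simp only [ne_eq, Nat.cast_eq_zero]
    omega)) (Or.inr (ENNReal.natCast_ne_top _)), mul_comm, ← div_eq_mul_inv]
  refine ENNReal.div_le_of_le_mul ?_
  have hfin : K + 2 ^ t + 1 ≤ runLenStar β (K + 2 ^ t + 1) * 2 ^ (j + 3) := by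
    have h1 : K + 2 ^ t + 1 ≤ 2 ^ t * 2 ^ (j + 3) := by
      rw [hKe, pow_add]
      nlinarith [Nat.one_le_two_pow (n := t), Nat.mul_le_mul hj1 (le_refl (2 ^ t))]
    exact h1.trans (Nat.mul_le_mul_right _ hrun)
  exact_mod_cast hfin

lemma orb_diff_upper {B β γ : ℝ} (hB : 2 ≤ B) (h0 : 0 ≤ β) (h1 : β ≤ γ) (h2 : γ ≤ B) (n : ℕ)
    (h : ∀ i < n, epsDig β i = epsDig γ i) :
    0 ≤ orb γ n - orb β n ∧ orb γ n - orb β n ≤ (B ^ n - 1) * (γ - β) := by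
  induction n with
  | zero => simp [orb_zero]
  | succ n ih =>
    obtain ⟨i1, i2⟩ := ih fun i hi => h i (by omega)
    have e : orb γ (n + 1) - orb β (n + 1)
        = γ * (orb γ n - orb β n) + (γ - β) * orb β n := by
      rw [orb_succ (by linarith), orb_succ (by linarith), h n (by omega)]
      ring
    have h3 := orb_nonneg β n
    have h4 := orb_le_one β n
    have h5 : 0 ≤ (γ - β) * orb β n := mul_nonneg (by linarith) h3
    have h6 : (γ - β) * orb β n ≤ (γ - β) * 1 := mul_le_mul_of_nonneg_left h4 (by linarith)
    have h7 : 0 ≤ γ * (orb γ n - orb β n) := mul_nonneg (by linarith) i1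
    have h8 : γ * (orb γ n - orb β n) ≤ B * ((B ^ n - 1) * (γ - β)) :=
      mul_le_mul h2 i2 i1 (by linarith)
    have h9 : 2 * (γ - β) ≤ B * (γ - β) := mul_le_mul_of_nonneg_right hB (by linarith)
    rw [e]
    refine ⟨by linarith, ?_⟩
    rw [pow_succ']
    linarith

lemma gap_lower {N : ℕ} {β γ : ℝ} (h0 : 0 ≤ β) (h1 : β ≤ γ) (h2 : γ ≤ N + 3) (n : ℕ)
    (h : ∀ i < n, epsDig β i = epsDig γ i) (hne : epsDig β n ≠ epsDig γ n)
    (hb : orb β (n + 1) ≤ N / (N + 1)) (hg : orb γ (n + 1) ≤ N / (N + 1)) :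
    1 / ((N : ℝ) + 1) ≤ ((N : ℝ) + 3) ^ (n + 1) * (γ - β) := by
  have hN : (0 : ℝ) ≤ N := Nat.cast_nonneg N
  obtain ⟨i1, i2⟩ := orb_diff_upper (B := (N : ℝ) + 3) (by linarith) h0 h1 h2 n h
  have eb := orb_succ h0 n
  have eg := orb_succ (h0.trans h1) n
  have nb := orb_nonneg β (n + 1)
  have ng := orb_nonneg γ (n + 1)
  have h3 := orb_nonneg β n
  have h4 := orb_le_one β n
  have h5 : 0 ≤ (γ - β) * orb β n := mul_nonneg (by linarith) h3
  have h6 : (γ - β) * orb β n ≤ (γ - β) * 1 := mul_le_mul_of_nonneg_left h4 (by linarith)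
  have h7 : 0 ≤ γ * (orb γ n - orb β n) := mul_nonneg (by linarith) i1
  have h8 : γ * (orb γ n - orb β n) ≤ (N + 3) * ((((N : ℝ) + 3) ^ n - 1) * (γ - β)) :=
    mul_le_mul h2 i2 i1 (by linarith)
  have hq : (N : ℝ) / (N + 1) = 1 - 1 / (N + 1) := by field_simp; ring
  have hq0 : 0 < 1 / ((N : ℝ) + 1) := by positivity
  rcases lt_or_gt_of_ne hne with hlt | hlt
  · have : (epsDig β n : ℝ) + 1 ≤ epsDig γ n := by exact_mod_cast hlt
    rw [pow_succ']
    have h9 : 0 ≤ ((N : ℝ) + 2) * (γ - β) := mul_nonneg (by linarith) (by linarith)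
    linarith
  · exfalso
    have : (epsDig γ n : ℝ) + 1 ≤ epsDig β n := by exact_mod_cast hlt
    linarith

lemma fpos_le {j : ℕ} (hj : 1 ≤ j) (k : ℕ) : (fpos j k : ℝ) ≤ 1 + k * (1 + (1 / 2 : ℝ) ^ j) := by
  have h1 : ((2 ^ (Nat.log 2 k) / 2 ^ j : ℕ) : ℝ) ≤ k * (1 / 2 : ℝ) ^ j := by
    rcases Nat.eq_zero_or_pos k with rfl | hk
    · have : 2 ^ (Nat.log 2 0) / 2 ^ j = 0 := by
        rw [Nat.log_zero_right]
        exact Nat.div_eq_of_lt (Nat.one_lt_two_pow (by omega))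
      rw [this]; simp
    · refine Nat.cast_div_le.trans ?_
      have h2 : ((2 ^ (Nat.log 2 k) : ℕ) : ℝ) ≤ k := by
        exact_mod_cast Nat.pow_log_le_self 2 hk.ne'
      rw [div_pow, one_pow, mul_one_div]
      push_cast at h2 ⊢
      gcongr
  unfold fpos
  push_cast at h1 ⊢
  linarith

lemma param_holder {N j : ℕ} {r : ℝ} (hN : 1 < N) (hj : 1 ≤ j) (hr : 0 < r)
    (hNr : ((N : ℝ) + 3) ^ (r * (1 + (1 / 2 : ℝ) ^ j)) ≤ N)
    {d e : ℕ → Fin N} {β γ : ℝ} (hβ : IsParam N j d β) (hγ : IsParam N j e γ) :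
    |Real.ofDigits d - Real.ofDigits e| ≤
      (((N : ℝ) + 1) * ((N : ℝ) + 3) ^ 2) ^ r * |β - γ| ^ r := by
  have hN0 : (0 : ℝ) < N := by positivity
  by_cases hde : d = e
  · rw [hde, sub_self, abs_zero]; positivity
  have hex : ∃ k, d k ≠ e k := by
    by_contra hcon
    push Not at hcon
    exact hde (funext hcon)
  classical
  let K := Nat.find hex
  have hK : d K ≠ e K := Nat.find_spec hex
  have hlt : ∀ k < K, d k = e k := fun k hk => by
    have := Nat.find_min hex hk
    push Not at this
    exact this
  have h1 := Real.abs_ofDigits_sub_ofDigits_le (n := K) hlt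
  refine h1.trans ?_
  have hag : ∀ i < fpos j K, aseq N j d i = aseq N j e i := by
    intro i hi
    rcases Nat.eq_zero_or_pos i with rfl | hi0
    · rw [aseq_zero, aseq_zero]
    by_cases hk : ∃ k, fpos j k = i
    · obtain ⟨k, rfl⟩ := hk
      rw [(fpos_strictMono j).lt_iff_lt] at hi
      rw [aseq_pos, aseq_pos, hlt k hi]
    · rw [aseq_not _ _ _ _ hi0.ne' hk, aseq_not _ _ _ _ hi0.ne' hk]
  have hdiff : aseq N j d (fpos j K) ≠ aseq N j e (fpos j K) := by
    rw [aseq_pos, aseq_pos]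
    intro h
    exact hK (Fin.ext (by omega))
  have hgap : 1 / ((N : ℝ) + 1) ≤ ((N : ℝ) + 3) ^ (fpos j K + 1) * |β - γ| := by
    rcases le_total β γ with hle | hle
    · rw [abs_sub_comm, abs_of_nonneg (by linarith)]
      refine gap_lower (by linarith [hβ.1.1]) hle hγ.1.2 _ ?_ ?_ (hβ.2 _).2 (hγ.2 _).2
      · intro i hi; rw [(hβ.2 i).1, (hγ.2 i).1]; exact hag i hi
      · rw [(hβ.2 _).1, (hγ.2 _).1]; exact hdiff
    · rw [abs_of_nonneg (by linarith)]
      refine gap_lower (by linarith [hγ.1.1]) hle hβ.1.2 _ ?_ ?_ (hγ.2 _).2 (hβ.2 _).2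
      · intro i hi; rw [(hβ.2 i).1, (hγ.2 i).1]; exact (hag i hi).symm
      · rw [(hβ.2 _).1, (hγ.2 _).1]; exact hdiff.symm
  have hB : (1 : ℝ) ≤ (N : ℝ) + 3 := by linarith
  have hB0 : (0 : ℝ) < (N : ℝ) + 3 := by linarith
  have hpow : (((N : ℝ) + 3) ^ (fpos j K + 1)) ^ r ≤ (((N : ℝ) + 3) ^ 2) ^ r * (N : ℝ) ^ K := by
    have e1 : (((N : ℝ) + 3) ^ (fpos j K + 1)) ^ r
        = ((N : ℝ) + 3) ^ (((fpos j K : ℝ) + 1) * r) := by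
      rw [← Real.rpow_natCast, ← Real.rpow_mul hB0.le]
      push_cast; rfl
    have e2 : (((N : ℝ) + 3) ^ 2) ^ r = ((N : ℝ) + 3) ^ (2 * r) := by
      rw [← Real.rpow_natCast, ← Real.rpow_mul hB0.le]
      push_cast; rfl
    have e3 : (((N : ℝ) + 3) ^ (r * (1 + (1 / 2 : ℝ) ^ j))) ^ K
        = ((N : ℝ) + 3) ^ (r * (1 + (1 / 2 : ℝ) ^ j) * K) := by
      rw [← Real.rpow_natCast, ← Real.rpow_mul hB0.le]
    calc (((N : ℝ) + 3) ^ (fpos j K + 1)) ^ r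
        ≤ ((N : ℝ) + 3) ^ (2 * r + r * (1 + (1 / 2 : ℝ) ^ j) * K) := by
          rw [e1]
          refine Real.rpow_le_rpow_of_exponent_le hB ?_
          have := mul_le_mul_of_nonneg_left (fpos_le hj K) hr.le
          linarith
      _ = (((N : ℝ) + 3) ^ 2) ^ r * (((N : ℝ) + 3) ^ (r * (1 + (1 / 2 : ℝ) ^ j))) ^ K := by
          rw [Real.rpow_add hB0, e2, e3]
      _ ≤ _ := by
          gcongr
  have h2 : (1 : ℝ) ≤ ((N : ℝ) + 1) * (((N : ℝ) + 3) ^ (fpos j K + 1) * |β - γ|) := by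
    rw [div_le_iff₀ (by positivity)] at hgap
    linarith
  have h3 := Real.rpow_le_rpow (by norm_num) h2 hr.le
  rw [Real.one_rpow, Real.mul_rpow (by positivity) (by positivity),
    Real.mul_rpow (by positivity) (by positivity)] at h3
  have h4 : (1 : ℝ) ≤ ((N : ℝ) + 1) ^ r * ((((N : ℝ) + 3) ^ 2) ^ r * (N : ℝ) ^ K * |β - γ| ^ r) := by
    refine h3.trans ?_
    gcongr
  rw [Real.mul_rpow (by positivity) (by positivity)]
  have h5 : ((N : ℝ)⁻¹) ^ K * (N : ℝ) ^ K = 1 := by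
    rw [← mul_pow, inv_mul_cancel₀ hN0.ne', one_pow]
  have h6 := mul_le_mul_of_nonneg_left h4 (show 0 ≤ ((N : ℝ)⁻¹) ^ K by positivity)
  rw [← inv_pow]
  calc ((N : ℝ)⁻¹) ^ K = ((N : ℝ)⁻¹) ^ K * 1 := by ring
    _ ≤ _ := h6
    _ = (((N : ℝ)⁻¹) ^ K * (N : ℝ) ^ K) *
      (((N : ℝ) + 1) ^ r * (((N : ℝ) + 3) ^ 2) ^ r * |β - γ| ^ r) := by ring
    _ = _ := by rw [h5, one_mul]

lemma exists_consts {r : ℝ} (hr : 0 < r) (hr1 : r < 1) : ∃ j N : ℕ, 1 ≤ j ∧ 1 < N ∧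
    ((N : ℝ) + 3) ^ (r * (1 + (1 / 2 : ℝ) ^ j)) ≤ N := by
  obtain ⟨i, hi⟩ := exists_pow_lt_of_lt_one (show 0 < 1 - r by linarith)
    (show (1 / 2 : ℝ) < 1 by norm_num)
  have hi' : (1 / 2 : ℝ) ^ (i + 1) < 1 - r := by
    rw [pow_succ]
    have : (0 : ℝ) < (1 / 2) ^ i := by positivity
    linarith
  have hp : (0 : ℝ) < (1 / 2) ^ (i + 1) := by positivity
  set s := r * (1 + (1 / 2 : ℝ) ^ (i + 1)) with hs
  have hs0 : 0 < s := by positivity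
  have hs1 : s < 1 := by nlinarith
  have ht := (tendsto_rpow_atTop (show 0 < 1 - s by linarith)).comp tendsto_natCast_atTop_atTop
  obtain ⟨N, hN1, hN2⟩ := ((ht.eventually_ge_atTop ((4 : ℝ) ^ s)).and
    (eventually_gt_atTop (1 : ℕ))).exists
  refine ⟨i + 1, N, by omega, hN2, ?_⟩
  have hN : (1 : ℝ) < N := by exact_mod_cast hN2
  simp only [Function.comp] at hN1
  calc ((N : ℝ) + 3) ^ s ≤ (4 * (N : ℝ)) ^ s :=
        Real.rpow_le_rpow (by linarith) (by linarith) hs0.le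
    _ = 4 ^ s * (N : ℝ) ^ s := Real.mul_rpow (by norm_num) (by linarith)
    _ ≤ (N : ℝ) ^ (1 - s) * (N : ℝ) ^ s := by gcongr
    _ = N := by
        rw [← Real.rpow_add (by linarith)]
        simp

lemma A2_dim_ge (r : NNReal) (hr : 0 < r) (hr1 : r < 1) : (r : ℝ≥0∞) ≤ dimH {β : ℝ | 1 < β ∧
        0 < limsup (fun n : ℕ => (runLenStar β n : ℝ≥0∞) / (n : ℝ≥0∞)) atTop} := by
  classical
  have hr' : (0 : ℝ) < r := by exact_mod_cast hr
  obtain ⟨j, N, hj, hN, hNr⟩ := exists_consts hr' (by exact_mod_cast hr1)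
  let E : Set ℝ := {β | ∃ d, IsParam N j d β}
  let g : ℝ → ℝ := fun β => if h : ∃ d, IsParam N j d β then Real.ofDigits h.choose else 0
  have hsub : E ⊆ {β : ℝ | 1 < β ∧
        0 < limsup (fun n : ℕ => (runLenStar β n : ℝ≥0∞) / (n : ℝ≥0∞)) atTop} := by
    rintro β ⟨d, hd⟩
    exact isParam_mem hd
  refine le_trans ?_ (dimH_mono hsub)
  have hgd : ∀ d β, IsParam N j d β → g β = Real.ofDigits d := by
    intro d β hd
    have h : ∃ d, IsParam N j d β := ⟨d, hd⟩
    have h1 : g β = Real.ofDigits h.choose := dif_pos h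
    rw [h1]
    have h2 := param_holder hN hj hr' hNr h.choose_spec hd
    rw [sub_self, abs_zero, Real.zero_rpow hr'.ne', mul_zero] at h2
    have h3 := abs_nonpos_iff.1 h2
    linarith
  have himg : Icc (0 : ℝ) 1 ⊆ g '' E := by
    intro x hx
    obtain ⟨d, _, rfl⟩ := Real.ofDigits_SurjOn hN hx
    obtain ⟨β, hβ⟩ := exists_isParam N j d
    exact ⟨β, ⟨d, hβ⟩, hgd d β hβ⟩
  let C : NNReal := Real.toNNReal ((((N : ℝ) + 1) * ((N : ℝ) + 3) ^ 2) ^ (r : ℝ))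
  have hol : HolderOnWith C r g E := by
    rintro β ⟨d, hd⟩ γ ⟨e, he⟩
    rw [hgd d β hd, hgd e γ he, edist_dist, edist_dist, Real.dist_eq, Real.dist_eq,
      ENNReal.ofReal_rpow_of_nonneg (abs_nonneg _) hr'.le]
    change _ ≤ ENNReal.ofReal _ * _
    rw [← ENNReal.ofReal_mul (by positivity)]
    exact ENNReal.ofReal_le_ofReal (param_holder hN hj hr' hNr hd he)
  have h1 := hol.dimH_image_le hr
  have h2 := dimH_mono himg
  have h3 : dimH (Icc (0 : ℝ) 1) = 1 := by
    rw [Real.dimH_of_nonempty_interior (by rw [interior_Icc]; exact nonempty_Ioo.2 one_pos)]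
    simp
  rw [h3] at h2
  have h4 := h2.trans h1
  rw [ENNReal.le_div_iff_mul_le (Or.inl (by exact_mod_cast hr.ne')) (Or.inl ENNReal.coe_ne_top),
    one_mul] at h4
  exact h4

lemma A2_dim : dimH {β : ℝ | 1 < β ∧
        0 < limsup (fun n : ℕ => (runLenStar β n : ℝ≥0∞) / (n : ℝ≥0∞)) atTop} = 1 := by
  refine le_antisymm ((dimH_mono (subset_univ _)).trans Real.dimH_univ.le) ?_
  refine le_of_forall_lt fun c hc => ?_
  obtain ⟨r, hr1, hr2⟩ := ENNReal.lt_iff_exists_nnreal_btwn.1 hc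
  have h0 : 0 < r := by
    have := lt_of_le_of_lt (zero_le) hr1
    exact_mod_cast this
  exact hr1.trans_le (A2_dim_ge r h0 (by exact_mod_cast hr2))

/-- Proposition 8.2. The set
`A₂ = {β > 1 : limsup ℓ_n(β)/n > 0}` is Lebesgue null and has Hausdorff
dimension 1. -/
theorem size_A2 :
    volume {β : ℝ | 1 < β ∧
        0 < limsup (fun n : ℕ => (runLenStar β n : ℝ≥0∞) / (n : ℝ≥0∞)) atTop} = 0 ∧
    dimH {β : ℝ | 1 < β ∧
        0 < limsup (fun n : ℕ => (runLenStar β n : ℝ≥0∞) / (n : ℝ≥0∞)) atTop} = 1 := by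
  exact ⟨A2_null, A2_dim⟩
end

section
/- The set A_0 = {β > 1 : the sequence (ℓ_n(β))_{n≥1} is bounded} has Lebesgue measure zero and Hausdorff dimension 1. -/
open Filter MeasureTheory Set
open scoped ENNReal

/-- The polynomials `P_k(β) = β^k - d_0 β^{k-1} - ... - d_{k-1}`. -/
noncomputable def polyP (d : ℕ → ℕ) : ℕ → ℝ → ℝ
  | 0, _ => 1
  | (k + 1), β => β * polyP d k β - d k

lemma polyP_zero (d : ℕ → ℕ) (β : ℝ) : polyP d 0 β = 1 := rfl

lemma polyP_succ (d : ℕ → ℕ) (k : ℕ) (β : ℝ) :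
    polyP d (k + 1) β = β * polyP d k β - d k := rfl

lemma polyP_continuous (d : ℕ → ℕ) (k : ℕ) : Continuous (polyP d k) := by
  induction k with
  | zero => exact continuous_const
  | succ k ih => exact (continuous_id.mul ih).sub continuous_const

lemma polyP_congr (d e : ℕ → ℕ) (k : ℕ) (β : ℝ) (h : ∀ i < k, d i = e i) :
    polyP d k β = polyP e k β := by
  induction k with
  | zero => rfl
  | succ k ih =>
    rw [polyP_succ, polyP_succ, ih (fun i hi => h i (by omega)), h k (by omega)]

lemma polyP_nonneg_down (d : ℕ → ℕ) (n : ℕ) (a : ℝ) (ha : 0 < a) (h : 0 ≤ polyP d n a) :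
    ∀ k ≤ n, 0 ≤ polyP d k a := by
  induction n with
  | zero => intro k hk; obtain rfl : k = 0 := by omega
            exact h
  | succ n ih =>
    intro k hk
    rcases Nat.lt_or_eq_of_le hk with hk | rfl
    · refine ih ?_ k (by omega)
      rw [polyP_succ] at h
      have h0 : (0 : ℝ) ≤ d n := Nat.cast_nonneg _
      by_contra hc
      push Not at hc
      nlinarith
    · exact h

lemma polyP_lower (d : ℕ → ℕ) (a b : ℝ) (hb : 0 ≤ b) (hab : a ≤ b) (n : ℕ)
    (h : ∀ k ≤ n, 0 ≤ polyP d k a) :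
    b ^ n * (b - a) ≤ polyP d (n + 1) b - polyP d (n + 1) a := by
  induction n with
  | zero => simp [polyP_succ, polyP_zero]
  | succ n ih =>
    have h1 := ih (fun k hk => h k (by omega))
    have h2 := h (n + 1) le_rfl
    rw [polyP_succ d (n + 1), polyP_succ d (n + 1)]
    generalize polyP d (n + 1) b = x at *
    generalize polyP d (n + 1) a = y at *
    have e : b * x - (d (n + 1) : ℝ) - (a * y - d (n + 1)) = (b - a) * y + b * (x - y) := by ring
    rw [e, pow_succ]
    nlinarith [mul_nonneg (sub_nonneg.2 hab) h2, mul_le_mul_of_nonneg_left h1 hb]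

lemma polyP_mono (d : ℕ → ℕ) (a b : ℝ) (hb : 0 ≤ b) (hab : a ≤ b) (n : ℕ)
    (h : ∀ k ≤ n, 0 ≤ polyP d k a) : ∀ k ≤ n, polyP d k a ≤ polyP d k b := by
  intro k hk
  cases k with
  | zero => exact le_rfl
  | succ k =>
    have := polyP_lower d a b hb hab k (fun i hi => h i (by omega))
    have h2 : 0 ≤ b ^ k * (b - a) := mul_nonneg (pow_nonneg hb _) (sub_nonneg.2 hab)
    linarith

lemma polyP_upper (d : ℕ → ℕ) (a b B : ℝ) (ha : 0 ≤ a) (hab : a ≤ b) (haB : a ≤ B) (hB : 1 < B)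
    (n : ℕ) (h : ∀ k < n, polyP d k b ≤ 1) :
    polyP d n b - polyP d n a ≤ (b - a) * ((B ^ n - 1) / (B - 1)) := by
  induction n with
  | zero => simp [polyP_zero]
  | succ n ih =>
    have h1 := ih (fun k hk => h k (by omega))
    have h2 := h n (by omega)
    rw [polyP_succ, polyP_succ]
    have e0 : (B ^ (n + 1) - 1) / (B - 1) = 1 + B * ((B ^ n - 1) / (B - 1)) := by
      have : B - 1 ≠ 0 := by linarith
      field_simp
      ring
    rw [e0]
    have hq : 0 ≤ (B ^ n - 1) / (B - 1) :=
      div_nonneg (by linarith [one_le_pow₀ (n := n) hB.le]) (by linarith)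
    generalize (B ^ n - 1) / (B - 1) = q at *
    generalize polyP d n b = x at *
    generalize polyP d n a = y at *
    have e : b * x - (d n : ℝ) - (a * y - d n) = (b - a) * x + a * (x - y) := by ring
    rw [e]
    have s1 := mul_le_mul_of_nonneg_left h2 (sub_nonneg.2 hab)
    have s2 := mul_le_mul_of_nonneg_left h1 ha
    have s3 : a * ((b - a) * q) ≤ B * ((b - a) * q) :=
      mul_le_mul_of_nonneg_right haB (mul_nonneg (sub_nonneg.2 hab) hq)
    linarith

lemma betaT_mem (β x : ℝ) : 0 ≤ betaT β x ∧ betaT β x < 1 := by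
  unfold betaT
  exact ⟨Int.fract_nonneg _, Int.fract_lt_one _⟩

lemma orbit_mem (β : ℝ) (n : ℕ) (hn : 1 ≤ n) :
    0 ≤ (betaT β)^[n] 1 ∧ (betaT β)^[n] 1 < 1 := by
  obtain ⟨m, rfl⟩ : ∃ m, n = m + 1 := ⟨n - 1, by omega⟩
  rw [Function.iterate_succ_apply']
  exact betaT_mem _ _

lemma orbit_nonneg (β : ℝ) (n : ℕ) : 0 ≤ (betaT β)^[n] 1 := by
  cases n with
  | zero => simp
  | succ n => exact (orbit_mem β (n + 1) (by omega)).1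

lemma orbit_le_one (β : ℝ) (n : ℕ) : (betaT β)^[n] 1 ≤ 1 := by
  cases n with
  | zero => simp
  | succ n => exact (orbit_mem β (n + 1) (by omega)).2.le

lemma orbit_succ (β : ℝ) (hβ : 1 < β) (n : ℕ) :
    (betaT β)^[n + 1] 1 = β * (betaT β)^[n] 1 - epsDig β n := by
  rw [Function.iterate_succ_apply']
  unfold epsDig
  have h : 0 ≤ ⌊β * (betaT β)^[n] 1⌋ :=
    Int.floor_nonneg.2 (mul_nonneg (by linarith) (orbit_nonneg β n))
  generalize (betaT β)^[n] 1 = x at *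
  unfold betaT
  congr 1
  have := Int.toNat_of_nonneg h
  exact_mod_cast this.symm

lemma orbit_eq_polyP (β : ℝ) (hβ : 1 < β) (n : ℕ) :
    (betaT β)^[n] 1 = polyP (epsDig β) n β := by
  induction n with
  | zero => rfl
  | succ n ih => rw [orbit_succ β hβ, polyP_succ, ih]

lemma epsDig_eq_of (β : ℝ) (n D : ℕ) (y : ℝ) (h : β * (betaT β)^[n] 1 = D + y)
    (h0 : 0 ≤ y) (h1 : y < 1) : epsDig β n = D := by
  unfold epsDig
  rw [h]
  have : ⌊(D : ℝ) + y⌋ = (D : ℤ) := by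
    rw [Int.floor_eq_iff]
    constructor
    · push_cast; linarith
    · push_cast; linarith
  rw [this]; simp

lemma digits_unique (d : ℕ → ℕ) (β : ℝ) (hβ : 1 < β) (n : ℕ)
    (h : ∀ k, 1 ≤ k → k ≤ n → 0 ≤ polyP d k β ∧ polyP d k β < 1) :
    (∀ k < n, epsDig β k = d k) ∧ ∀ k ≤ n, (betaT β)^[k] 1 = polyP d k β := by
  induction n with
  | zero => exact ⟨fun k hk => by omega, fun k hk => by
      obtain rfl : k = 0 := by omega
      rfl⟩
  | succ n ih =>
    obtain ⟨h1, h2⟩ := ih (fun k hk hk' => h k hk (by omega))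
    have h3 := h (n + 1) (by omega) le_rfl
    have h4 : epsDig β n = d n := by
      refine epsDig_eq_of β n (d n) (polyP d (n + 1) β) ?_ h3.1 h3.2
      rw [h2 n le_rfl, polyP_succ]; ring
    refine ⟨fun k hk => ?_, fun k hk => ?_⟩
    · rcases Nat.lt_or_eq_of_le (Nat.lt_succ_iff.1 hk) with hk | rfl
      · exact h1 k hk
      · exact h4
    · rcases Nat.lt_or_eq_of_le hk with hk | rfl
      · exact h2 k (by omega)
      · rw [orbit_succ β hβ, h2 n le_rfl, h4, polyP_succ]

/-- If `x_n(β) < β^{-(M+1)}` then digits `n, ..., n+M` vanish. -/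
lemma zeros_of_small (β : ℝ) (hβ : 1 < β) (n M : ℕ)
    (h : β ^ (M + 1) * (betaT β)^[n] 1 < 1) : ∀ j ≤ M, epsDig β (n + j) = 0 := by
  have key : ∀ j ≤ M + 1, (betaT β)^[n + j] 1 = β ^ j * (betaT β)^[n] 1 ∧
      ∀ i < j, epsDig β (n + i) = 0 := by
    intro j
    induction j with
    | zero => intro _; simp
    | succ j ih =>
      intro hj
      obtain ⟨h1, h2⟩ := ih (by omega)
      have h3 : β * (betaT β)^[n + j] 1 < 1 := by
        rw [h1, ← mul_assoc, ← pow_succ']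
        refine lt_of_le_of_lt ?_ h
        exact mul_le_mul_of_nonneg_right (pow_le_pow_right₀ hβ.le hj) (orbit_nonneg β n)
      have h4 : epsDig β (n + j) = 0 :=
        epsDig_eq_of β (n + j) 0 (β * (betaT β)^[n + j] 1) (by simp)
          (mul_nonneg (by linarith) (orbit_nonneg _ _)) h3
      refine ⟨?_, fun i hi => ?_⟩
      · rw [← add_assoc, orbit_succ β hβ, h4, h1, pow_succ]; push_cast; ring
      · rcases Nat.lt_or_eq_of_le (Nat.lt_succ_iff.1 hi) with hi | rfl
        · exact h2 i hi
        · exact h4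
  exact fun j hj => (key (M + 1) le_rfl).2 j (by omega)

lemma epsDig_zero_pos (β : ℝ) (hβ : 1 < β) : 1 ≤ epsDig β 0 := by
  have h := (orbit_mem β 1 le_rfl).2
  have h2 := orbit_succ β hβ 0
  simp only [zero_add, Function.iterate_zero, id] at h2
  by_contra hc
  have : epsDig β 0 = 0 := by omega
  rw [this] at h2
  push_cast at h2
  rw [h2] at h
  linarith

/-- The expansion of one determines `β`. -/
lemma epsDig_inj (a b : ℝ) (ha : 1 < a) (hb : 1 < b) (h : ∀ n, epsDig a n = epsDig b n) :
    a = b := by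
  have main : ∀ a b : ℝ, 1 < a → a < b → (∀ n, epsDig a n = epsDig b n) → False := by
    intro a b ha hab h
    have hb : 1 < b := ha.trans hab
    obtain ⟨n, hn⟩ := pow_unbounded_of_one_lt (1 / (b - a)) hb
    have h1 := polyP_lower (epsDig a) a b (by linarith) hab.le n (fun k _ => by
      rw [← orbit_eq_polyP a ha]; exact orbit_nonneg _ _)
    rw [polyP_congr (epsDig a) (epsDig b) (n + 1) b (fun i _ => h i), ← orbit_eq_polyP a ha,
      ← orbit_eq_polyP b hb] at h1
    have h2 := orbit_mem a (n + 1) (by omega)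
    have h3 := orbit_mem b (n + 1) (by omega)
    rw [div_lt_iff₀ (by linarith)] at hn
    linarith
  rcases lt_trichotomy a b with hab | hab | hab
  · exact (main a b ha hab h).elim
  · exact hab
  · exact (main b a hb hab (fun n => (h n).symm)).elim

lemma countable_finite :
    {β : ℝ | 1 < β ∧ ∃ m, epsDig β m ≠ 0 ∧ ∀ i, m < i → epsDig β i = 0}.Countable := by
  have : {β : ℝ | 1 < β ∧ ∃ m, epsDig β m ≠ 0 ∧ ∀ i, m < i → epsDig β i = 0} ⊆
      ⋃ m : ℕ, {β : ℝ | 1 < β ∧ ∀ i, m < i → epsDig β i = 0} := by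
    rintro β ⟨h1, m, -, h2⟩
    exact mem_iUnion.2 ⟨m, h1, h2⟩
  refine Set.Countable.mono this (countable_iUnion fun m => ?_)
  refine Set.countable_of_injective_of_countable_image
    (f := fun β => (fun i : Fin (m + 1) => epsDig β i)) ?_ (Set.to_countable _)
  rintro a ⟨ha, ha'⟩ b ⟨hb, hb'⟩ hab
  refine epsDig_inj a b ha hb fun n => ?_
  by_cases hn : n < m + 1
  · exact congrFun hab ⟨n, hn⟩
  · rw [ha' n (by omega), hb' n (by omega)]

/-- Parameters whose digits have no more than `M` consecutive zeros. -/
def BM (M : ℕ) : Set ℝ := {β | 1 < β ∧ ∀ n, ∃ j ≤ M, epsDig β (n + j) ≠ 0}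

lemma A0_subset : {β : ℝ | 1 < β ∧ BddAbove (Set.range fun n : ℕ => runLenStar β n)} ⊆
    {β : ℝ | 1 < β ∧ ∃ m, epsDig β m ≠ 0 ∧ ∀ i, m < i → epsDig β i = 0} ∪ ⋃ M, BM M := by
  rintro β ⟨hβ, M, hM⟩
  by_cases h : ∃ m, epsDig β m ≠ 0 ∧ ∀ i, m < i → epsDig β i = 0
  · exact Or.inl ⟨hβ, h⟩
  · right
    refine mem_iUnion.2 ⟨M, hβ, fun n => ?_⟩
    have hs : epsStar β = epsDig β := by
      unfold epsStar
      rw [dif_neg h]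
    have hnz : ∃ i, epsDig β (n + i) ≠ 0 := by
      by_contra hc
      push Not at hc
      have hex : ∃ m, ∀ i, m ≤ i → epsDig β i = 0 :=
        ⟨n, fun i hi => by rw [← Nat.add_sub_cancel' hi]; exact hc _⟩
      classical
      have hsp := Nat.find_spec hex
      have hmin := fun k => Nat.find_min hex (m := k)
      generalize Nat.find hex = m at hsp hmin
      cases m with
      | zero => have := epsDig_zero_pos β hβ; have := hsp 0 le_rfl; omega
      | succ m =>
        refine h ⟨m, fun h0 => hmin m (by omega) fun i hi => ?_, fun i hi => hsp i hi⟩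
        rcases Nat.lt_or_eq_of_le hi with hi | rfl
        · exact hsp i hi
        · exact h0
    obtain ⟨i, hi⟩ := hnz
    by_contra hc
    push Not at hc
    have h1 : M + 1 ≤ runLenStar β n := by
      unfold runLenStar
      refine le_csSup ⟨i, fun k hk => ?_⟩ ?_
      · by_contra hki
        exact hi (by rw [← hs]; exact hk i (by omega))
      · intro j hj
        rw [hs]; exact hc j (by omega)
    have h2 : runLenStar β n ≤ M := hM ⟨n, rfl⟩
    omega

lemma polyP_one_nonpos (d : ℕ → ℕ) (hd : 1 ≤ d 0) (n : ℕ) : polyP d (n + 1) 1 ≤ 0 := by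
  induction n with
  | zero =>
    have : (1 : ℝ) ≤ d 0 := by exact_mod_cast hd
    simp only [polyP_succ, polyP_zero]; linarith
  | succ n ih =>
    rw [polyP_succ]
    have : (0 : ℝ) ≤ d (n + 1) := Nat.cast_nonneg _
    linarith

/-- Near every point of `BM M` there are relatively large holes of `BM M`, at all scales. -/
lemma hole (M : ℕ) (x : ℝ) (hx : x ∈ BM M) : ∃ K : ℝ, ∀ n : ℕ, ∃ w δ : ℝ, 0 < δ ∧
    δ ≤ (1 / x) ^ n ∧ BM M ∩ Metric.closedBall w δ = ∅ ∧ x ∈ Metric.closedBall w (K * δ) := by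
  obtain ⟨hx1, hx2⟩ := hx
  have hxp : 0 < x := by linarith
  set c : ℝ := (x ^ (M + 1))⁻¹ with hc
  have hcpos : 0 < c := by positivity
  refine ⟨4 * x / ((x - 1) * c), fun n => ?_⟩
  set d := epsDig x with hd
  set P := polyP d (n + 1) with hP
  have hPx : P x = (betaT x)^[n + 1] 1 := (orbit_eq_polyP x hx1 (n + 1)).symm
  have hPc : c ≤ P x := by
    by_contra hlt
    push Not at hlt
    obtain ⟨j, hj, hj'⟩ := hx2 (n + 1)
    refine hj' (zeros_of_small x hx1 (n + 1) M ?_ j hj)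
    rw [← hPx]
    calc x ^ (M + 1) * P x < x ^ (M + 1) * c := by gcongr
      _ = 1 := by rw [hc]; field_simp
  have hcont : Continuous P := polyP_continuous d (n + 1)
  obtain ⟨a, ⟨ha1, hax⟩, hPa⟩ : ∃ a ∈ Set.Icc (1 : ℝ) x, P a = 0 :=
    intermediate_value_Icc hx1.le hcont.continuousOn
      ⟨polyP_one_nonpos d (epsDig_zero_pos x hx1) n, by linarith⟩
  obtain ⟨b, ⟨hab, hbx⟩, hPb⟩ : ∃ b ∈ Set.Icc a x, P b = c :=
    intermediate_value_Icc hax hcont.continuousOn ⟨by linarith, hPc⟩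
  have hab' : a < b := by
    rcases hab.lt_or_eq with h | h
    · exact h
    · rw [← h, hPa] at hPb; linarith
  have hanon : ∀ k ≤ n + 1, 0 ≤ polyP d k a :=
    polyP_nonneg_down d (n + 1) a (by linarith) hPa.ge
  -- every point strictly between `a` and `b` is outside `BM M`
  have hout : ∀ y, a < y → y < b → y ∉ BM M := by
    rintro y hay hyb ⟨hy1, hy2⟩
    have hynon : ∀ k ≤ n + 1, 0 ≤ polyP d k y := fun k hk =>
      (hanon k hk).trans (polyP_mono d a y (by linarith) hay.le (n + 1) hanon k hk)
    have hyle : ∀ k ≤ n + 1, polyP d k y ≤ polyP d k x :=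
      polyP_mono d y x hxp.le (by linarith) (n + 1) hynon
    obtain ⟨-, horb⟩ := digits_unique d y hy1 (n + 1) (fun k hk hk' => by
      refine ⟨hynon k hk', (hyle k hk').trans_lt ?_⟩
      rw [hd, ← orbit_eq_polyP x hx1]
      exact (orbit_mem x k hk).2)
    have hlt : P y < c := by
      have h1 := polyP_lower d y b (by linarith) hyb.le n (fun k hk => hynon k (by omega))
      have h2 : 0 < b ^ n * (b - y) := mul_pos (pow_pos (by linarith) _) (by linarith)
      rw [← hP] at h1
      linarith
    obtain ⟨j, hj, hj'⟩ := hy2 (n + 1)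
    refine hj' (zeros_of_small y hy1 (n + 1) M ?_ j hj)
    rw [horb (n + 1) le_rfl, ← hP]
    have hPy : 0 ≤ P y := hynon _ le_rfl
    calc y ^ (M + 1) * P y ≤ x ^ (M + 1) * P y := by gcongr; linarith
      _ < x ^ (M + 1) * c := by gcongr
      _ = 1 := by rw [hc]; field_simp
  have hlow : x ^ n * (x - a) ≤ 1 := by
    have h1 := polyP_lower d a x hxp.le hax n (fun k hk => hanon k (by omega))
    rw [← hP, hPa, hPx] at h1
    linarith [orbit_le_one x (n + 1)]
  have hup : c * (x - 1) ≤ (b - a) * x ^ (n + 1) := by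
    have hbnon : ∀ k ≤ n + 1, 0 ≤ polyP d k b := fun k hk =>
      (hanon k hk).trans (polyP_mono d a b (by linarith) hab (n + 1) hanon k hk)
    have h1 := polyP_upper d a b x (by linarith) hab hax hx1 (n + 1) (fun k hk => by
      refine (polyP_mono d b x hxp.le hbx (n + 1) hbnon k (by omega)).trans ?_
      rw [hd, ← orbit_eq_polyP x hx1]
      exact orbit_le_one x k)
    rw [← hP, hPa, hPb, sub_zero, ← mul_div_assoc, le_div_iff₀ (by linarith)] at h1
    linarith
  refine ⟨(a + b) / 2, (b - a) / 4, by linarith, ?_, ?_, ?_⟩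
  · rw [one_div, inv_pow]
    have : x - a ≤ (x ^ n)⁻¹ := by
      rw [← one_div, le_div_iff₀ (by positivity)]
      linarith
    linarith
  · rw [Set.eq_empty_iff_forall_notMem]
    rintro y ⟨hy, hy2⟩
    rw [Metric.mem_closedBall, Real.dist_eq, abs_le] at hy2
    exact hout y (by linarith) (by linarith) hy
  · rw [Metric.mem_closedBall, Real.dist_eq, abs_of_nonneg (by linarith)]
    have h3 : x - a ≤ 4 * x / ((x - 1) * c) * ((b - a) / 4) := by
      have e : 4 * x / ((x - 1) * c) * ((b - a) / 4) = x * (b - a) / ((x - 1) * c) := by ring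
      rw [e, le_div_iff₀ (mul_pos (by linarith) hcpos)]
      have h4 : (x - a) * (c * (x - 1)) ≤ (x - a) * ((b - a) * x ^ (n + 1)) :=
        mul_le_mul_of_nonneg_left hup (by linarith)
      have h5 : (x * (b - a)) * (x ^ n * (x - a)) ≤ (x * (b - a)) * 1 :=
        mul_le_mul_of_nonneg_left hlow (mul_nonneg hxp.le (by linarith))
      rw [pow_succ] at h4
      nlinarith
    linarith

lemma BM_null (M : ℕ) : volume (BM M) = 0 := by
  have hall : ∀ᵐ x ∂(volume.restrict (BM M)), ∀ K : ℕ,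
      ∀ (w : ℕ → ℝ) (δ : ℕ → ℝ) (_ : Tendsto δ atTop (nhdsWithin 0 (Set.Ioi 0)))
      (_ : ∀ᶠ j in atTop, x ∈ Metric.closedBall (w j) ((K : ℝ) * δ j)),
      Tendsto (fun j => volume (BM M ∩ Metric.closedBall (w j) (δ j)) /
        volume (Metric.closedBall (w j) (δ j))) atTop (nhds 1) := by
    rw [ae_all_iff]
    intro K
    filter_upwards [IsUnifLocDoublingMeasure.ae_tendsto_measure_inter_div
      (volume : Measure ℝ) (BM M) (K : ℝ)] with x hx w δ h1 h2
    exact hx w δ h1 h2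
  have hnot : ∀ᵐ x ∂(volume.restrict (BM M)), x ∉ BM M := by
    filter_upwards [hall] with x hx hxM
    obtain ⟨K, hK⟩ := hole M x hxM
    obtain ⟨K', hK'⟩ := exists_nat_ge K
    choose w δ h1 h2 h3 h4 using hK
    have hx1 : 1 < x := hxM.1
    have hlim : Tendsto δ atTop (nhdsWithin 0 (Set.Ioi 0)) := by
      rw [tendsto_nhdsWithin_iff]
      refine ⟨?_, Eventually.of_forall h1⟩
      refine squeeze_zero (fun n => (h1 n).le) h2 ?_
      refine tendsto_pow_atTop_nhds_zero_of_lt_one (by positivity) ?_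
      rw [div_lt_one (by linarith)]; exact hx1
    have ht := hx K' w δ hlim (Eventually.of_forall fun j =>
      Metric.closedBall_subset_closedBall
        (mul_le_mul_of_nonneg_right hK' (h1 j).le) (h4 j))
    simp only [h3, measure_empty, ENNReal.zero_div] at ht
    exact zero_ne_one (tendsto_nhds_unique tendsto_const_nhds ht)
  -- no measurability of `BM M` is needed
  have h5 := (ae_iff.1 hnot)
  simp only [not_not, Set.ofPred_mem_eq] at h5
  rwa [Measure.restrict_apply_self] at h5

lemma A0_null :
    volume {β : ℝ | 1 < β ∧ BddAbove (Set.range fun n : ℕ => runLenStar β n)} = 0 := by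
  refine measure_mono_null A0_subset (measure_union_null ?_ ?_)
  · exact countable_finite.measure_zero _
  · exact measure_iUnion_null BM_null


/-- Parameters with first digit `b + 1` and all further digits in `{1, ..., b}`. -/
def EB (b : ℕ) : Set ℝ := {β | ((b : ℝ) + 1 ≤ β ∧ β ≤ b + 2) ∧ epsDig β 0 = b + 1 ∧
  ∀ i, 1 ≤ epsDig β (i + 1) ∧ epsDig β (i + 1) ≤ b}

lemma EB_subset (b : ℕ) (hb : 1 ≤ b) :
    EB b ⊆ {β : ℝ | 1 < β ∧ BddAbove (Set.range fun n : ℕ => runLenStar β n)} := by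
  rintro β ⟨⟨h1, -⟩, h0, h2⟩
  have hb' : (1 : ℝ) ≤ b := by exact_mod_cast hb
  refine ⟨by linarith, 0, ?_⟩
  have hnz : ∀ i, epsDig β i ≠ 0 := by
    intro i
    cases i with
    | zero => omega
    | succ i => have := h2 i; omega
  have hs : epsStar β = epsDig β := by
    unfold epsStar
    rw [dif_neg]
    rintro ⟨m, -, hm⟩
    exact hnz (m + 1) (hm (m + 1) (by omega))
  rintro _ ⟨n, rfl⟩
  simp only [runLenStar, hs]
  refine csSup_le ⟨0, by simp⟩ ?_
  intro k hk
  by_contra hc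
  exact hnz _ (hk 0 (by omega))

/-- Existence of a base with prescribed digits. -/
lemma exists_base (b : ℕ) (hb : 1 ≤ b) (d : ℕ → ℕ) (h0 : d 0 = b + 1)
    (hd : ∀ i, 1 ≤ d (i + 1) ∧ d (i + 1) ≤ b) :
    ∃ β ∈ EB b, ∀ i, epsDig β i = d i := by
  have hb' : (1 : ℝ) ≤ b := by exact_mod_cast hb
  have hd1 : ∀ i, (1 : ℝ) ≤ d (i + 1) := fun i => by exact_mod_cast (hd i).1
  have hd2 : ∀ i, (d (i + 1) : ℝ) ≤ b := fun i => by exact_mod_cast (hd i).2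
  have h0' : (d 0 : ℝ) = b + 1 := by rw [h0]; push_cast; ring
  let t : ℕ → Set ℝ := fun n => Set.Icc ((b : ℝ) + 1) (b + 2) ∩ polyP d (n + 1) ⁻¹' Set.Icc 0 1
  have hclosed : ∀ n, IsClosed (t n) := fun n =>
    isClosed_Icc.inter (isClosed_Icc.preimage (polyP_continuous d (n + 1)))
  have hmono : ∀ n, t (n + 1) ⊆ t n := by
    rintro n β ⟨⟨hβ1, hβ2⟩, h1, h2⟩
    rw [polyP_succ] at h1 h2
    refine ⟨⟨hβ1, hβ2⟩, ?_, ?_⟩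
    · by_contra hc
      push Not at hc
      nlinarith [hd1 n]
    · by_contra hc
      push Not at hc
      nlinarith [hd2 n]
  have hlow : ∀ n, polyP d (n + 1) ((b : ℝ) + 1) ≤ 0 := by
    intro n
    induction n with
    | zero => simp [polyP_succ, polyP_zero, h0']
    | succ n ih =>
      rw [polyP_succ]
      nlinarith [hd1 n]
  have hhigh : ∀ n, 1 ≤ polyP d (n + 1) ((b : ℝ) + 2) := by
    intro n
    induction n with
    | zero => simp only [polyP_succ, polyP_zero, h0']; linarith
    | succ n ih =>
      rw [polyP_succ]
      nlinarith [hd2 n]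
  have hne : ∀ n, (t n).Nonempty := by
    intro n
    obtain ⟨β, hβ, hβ0⟩ : ∃ β ∈ Set.Icc ((b : ℝ) + 1) (b + 2), polyP d (n + 1) β = 0 :=
      intermediate_value_Icc (by linarith) (polyP_continuous d (n + 1)).continuousOn
        ⟨hlow n, by linarith [hhigh n]⟩
    refine ⟨β, hβ, ?_⟩
    simp [hβ0]
  obtain ⟨β, hβ⟩ := IsCompact.nonempty_iInter_of_sequence_nonempty_isCompact_isClosed t hmono hne
    (isCompact_Icc.of_isClosed_subset (hclosed 0) inter_subset_left) hclosed
  have hβ' : ∀ n, β ∈ t n := fun n => mem_iInter.1 hβ n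
  have hβI := (hβ' 0).1
  have hP : ∀ n, 0 ≤ polyP d (n + 1) β ∧ polyP d (n + 1) β ≤ 1 := fun n => (hβ' n).2
  have hβgt : (b : ℝ) + 1 < β := by
    have h1 := (hP 1).1
    rw [polyP_succ, polyP_succ, polyP_zero, h0'] at h1
    have h2 := hd1 0
    by_contra hc
    have : β = b + 1 := le_antisymm (not_lt.1 hc) hβI.1
    rw [this] at h1
    simp at h1
    simp at h2
    linarith
  have hlt : ∀ n, polyP d (n + 1) β < 1 := by
    intro n
    have h1 := (hP (n + 1)).2
    rw [polyP_succ] at h1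
    by_contra hc
    push Not at hc
    nlinarith [hd2 n]
  have hdig : ∀ i, epsDig β i = d i := fun i =>
    (digits_unique d β (by linarith) (i + 1) (fun k hk _ => by
      obtain ⟨m, rfl⟩ : ∃ m, k = m + 1 := ⟨k - 1, by omega⟩
      exact ⟨(hP m).1, hlt m⟩)).1 i (by omega)
  exact ⟨β, ⟨hβI, by rw [hdig, h0], fun i => by rw [hdig]; exact hd i⟩, hdig⟩

/-- Reads the digits of the expansion as a base `b` expansion. -/
noncomputable def readF (b : ℕ) [NeZero b] (β : ℝ) : ℝ :=
  Real.ofDigits (fun i => Fin.ofNat b (epsDig β (i + 1) - 1))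

lemma readF_surj (b : ℕ) [NeZero b] (hb : 2 ≤ b) : Set.Icc (0 : ℝ) 1 ⊆ readF b '' EB b := by
  intro y hy
  obtain ⟨e, -, he⟩ := Real.ofDigits_SurjOn (b := b) (by omega) hy
  obtain ⟨β, hβ, hdig⟩ := exists_base b (by omega)
    (fun i => if i = 0 then b + 1 else (e (i - 1) : ℕ) + 1) (by simp) (fun i => by
      have := (e i).2
      simp)
  refine ⟨β, hβ, ?_⟩
  rw [← he]
  unfold readF
  congr 1
  funext i
  rw [hdig]
  simp

/-- Separation estimate: bases whose expansions first differ at index `m` are far apart. -/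
lemma sep (b : ℕ) (hb : 1 ≤ b) (x y : ℝ) (hx : x ∈ EB b) (hy : y ∈ EB b) (hyx : y < x) (m : ℕ)
    (hag : ∀ i < m, epsDig x i = epsDig y i) (hne : epsDig x m ≠ epsDig y m) :
    1 ≤ (x - y) * ((b : ℝ) + 2) ^ (m + 2) := by
  have hb' : (1 : ℝ) ≤ b := by exact_mod_cast hb
  obtain ⟨⟨hx1, hx2⟩, hx0, hxd⟩ := hx
  obtain ⟨⟨hy1, hy2⟩, hy0, hyd⟩ := hy
  have hxx : 1 < x := by linarith
  have hyy : 1 < y := by linarith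
  set B : ℝ := (b : ℝ) + 2 with hB
  have hPx : ∀ k ≤ m, polyP (epsDig y) k x = (betaT x)^[k] 1 := fun k hk => by
    rw [orbit_eq_polyP x hxx]
    exact polyP_congr _ _ _ _ fun i hi => (hag i (by omega)).symm
  have hup := polyP_upper (epsDig y) y x B (by linarith) hyx.le (by linarith) (by linarith)
    (m + 1) (fun k hk => by rw [hPx k (by omega)]; exact orbit_le_one x k)
  have hlow := polyP_lower (epsDig y) y x (by linarith) hyx.le m (fun k _ => by
    rw [← orbit_eq_polyP y hyy]; exact orbit_nonneg y k)
  rw [polyP_succ (epsDig y) m x, hPx m le_rfl, ← orbit_eq_polyP y hyy] at hup hlow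
  have hox := orbit_succ x hxx m
  have hox1 := orbit_mem x (m + 1) (by omega)
  have hoy1 := orbit_mem y (m + 1) (by omega)
  have hpos : 0 < x ^ m * (x - y) := mul_pos (by positivity) (by linarith)
  -- the digit of the larger base is larger
  have hdlt : epsDig y m < epsDig x m := by
    by_contra hc
    have h1 : epsDig x m + 1 ≤ epsDig y m := by omega
    have h2 : (epsDig x m : ℝ) + 1 ≤ epsDig y m := by exact_mod_cast h1
    linarith
  have hdlt' : (epsDig y m : ℝ) + 1 ≤ epsDig x m := by exact_mod_cast hdlt
  -- the next digit of `x` is nonzero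
  have hnext : 1 ≤ x * (betaT x)^[m + 1] 1 := by
    have h1 := orbit_succ x hxx (m + 1)
    have h2 := (orbit_mem x (m + 1 + 1) (by omega)).1
    have h3 : (1 : ℝ) ≤ epsDig x (m + 1) := by exact_mod_cast (hxd m).1
    linarith
  have hnextB : 1 ≤ B * (betaT x)^[m + 1] 1 :=
    hnext.trans (mul_le_mul_of_nonneg_right hx2 hox1.1)
  have hD : (betaT x)^[m + 1] 1 ≤ (x - y) * ((B ^ (m + 1) - 1) / (B - 1)) := by linarith
  have hq : (B ^ (m + 1) - 1) / (B - 1) ≤ B ^ (m + 1) := by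
    have hBp : 0 < B ^ (m + 1) := by positivity
    rw [div_le_iff₀ (by linarith)]
    nlinarith
  have hD2 : (betaT x)^[m + 1] 1 ≤ (x - y) * B ^ (m + 1) :=
    hD.trans (mul_le_mul_of_nonneg_left hq (by linarith))
  have := mul_le_mul_of_nonneg_left hD2 (show 0 ≤ B by linarith)
  calc (1 : ℝ) ≤ _ := hnextB
    _ ≤ _ := this
    _ = _ := by ring

/-- The Hölder exponent. -/
noncomputable def rexp (b : ℕ) : ℝ := Real.log b / Real.log (b + 2)

lemma rexp_pow (b : ℕ) (hb : 2 ≤ b) : ((b : ℝ) + 2) ^ rexp b = b := by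
  have hb' : (2 : ℝ) ≤ b := by exact_mod_cast hb
  have hl : 0 < Real.log ((b : ℝ) + 2) := Real.log_pos (by linarith)
  rw [Real.rpow_def_of_pos (by linarith), rexp, mul_div_cancel₀ _ hl.ne',
    Real.exp_log (by linarith)]

lemma rexp_pos (b : ℕ) (hb : 2 ≤ b) : 0 < rexp b := by
  have hb' : (2 : ℝ) ≤ b := by exact_mod_cast hb
  exact div_pos (Real.log_pos (by linarith)) (Real.log_pos (by linarith))

lemma readF_holder_aux (b : ℕ) [NeZero b] (hb : 2 ≤ b) (x y : ℝ) (hx : x ∈ EB b) (hy : y ∈ EB b)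
    (hyx : y < x) : |readF b x - readF b y| ≤ (b : ℝ) ^ 3 * (x - y) ^ rexp b := by
  have hb' : (2 : ℝ) ≤ b := by exact_mod_cast hb
  have hex : ∃ m, epsDig x m ≠ epsDig y m := by
    by_contra hc
    push Not at hc
    have := epsDig_inj x y (by linarith [hx.1.1]) (by linarith [hy.1.1]) hc
    linarith
  classical
  have hne := Nat.find_spec hex
  have hag := fun k => Nat.find_min hex (m := k)
  generalize Nat.find hex = m at hne hag
  replace hag : ∀ i < m, epsDig x i = epsDig y i := fun i hi => not_not.1 (hag i hi)
  have hs := sep b (by omega) x y hx hy hyx m hag hne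
  obtain ⟨n, rfl⟩ : ∃ n, m = n + 1 := by
    cases m with
    | zero => exact absurd (hx.2.1.trans hy.2.1.symm) hne
    | succ n => exact ⟨n, rfl⟩
  have h1 : |readF b x - readF b y| ≤ ((b : ℝ) ^ n)⁻¹ :=
    Real.abs_ofDigits_sub_ofDigits_le fun i hi => by
      rw [hag (i + 1) (by omega)]
  refine h1.trans ?_
  have hxy : 0 ≤ x - y := by linarith
  have h2 : (1 : ℝ) ≤ ((x - y) * ((b : ℝ) + 2) ^ (n + 3)) ^ rexp b :=
    Real.one_le_rpow hs (rexp_pos b hb).le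
  rw [Real.mul_rpow hxy (by positivity), ← Real.rpow_natCast, ← Real.rpow_mul (by positivity),
    mul_comm ((n + 3 : ℕ) : ℝ), Real.rpow_mul (by positivity), rexp_pow b hb,
    Real.rpow_natCast] at h2
  rw [inv_le_iff_one_le_mul₀ (by positivity)]
  calc (1 : ℝ) ≤ _ := h2
    _ = _ := by ring

lemma dim_EB (b : ℕ) (hb : 2 ≤ b) : ENNReal.ofReal (rexp b) ≤ dimH (EB b) := by
  have : NeZero b := ⟨by omega⟩
  have hr := rexp_pos b hb
  have hH : HolderOnWith ((b : NNReal) ^ 3) (rexp b).toNNReal (readF b) (EB b) := by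
    intro x hx y hy
    have key : dist (readF b x) (readF b y) ≤ (b : ℝ) ^ 3 * dist x y ^ rexp b := by
      rw [Real.dist_eq, Real.dist_eq]
      rcases lt_trichotomy x y with h | h | h
      · rw [abs_sub_comm, abs_sub_comm x y, abs_of_pos (sub_pos.2 h)]
        exact readF_holder_aux b hb y x hy hx h
      · subst h
        simp only [sub_self, abs_zero]
        rw [Real.zero_rpow hr.ne', mul_zero]
      · rw [abs_of_pos (sub_pos.2 h)]
        exact readF_holder_aux b hb x y hx hy h
    rw [Real.coe_toNNReal _ hr.le, edist_dist, edist_dist,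
      ENNReal.ofReal_rpow_of_nonneg dist_nonneg hr.le]
    refine (ENNReal.ofReal_le_ofReal key).trans_eq ?_
    rw [ENNReal.ofReal_mul (by positivity)]
    congr 1
    rw [ENNReal.ofReal_pow (by positivity), ENNReal.ofReal_natCast]
    simp
  have h1 := hH.dimH_image_le (Real.toNNReal_pos.2 hr)
  have h2 : dimH (Set.Icc (0 : ℝ) 1) = 1 := by
    rw [Real.dimH_of_nonempty_interior (by rw [interior_Icc]; exact ⟨1 / 2, by norm_num⟩)]
    simp
  have h3 : (1 : ℝ≥0∞) ≤ dimH (EB b) / ((rexp b).toNNReal : ℝ≥0∞) :=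
    h2 ▸ (dimH_mono (readF_surj b hb)).trans h1
  rw [ENNReal.le_div_iff_mul_le (Or.inl (by simpa using hr)) (Or.inl ENNReal.coe_ne_top),
    one_mul] at h3
  exact h3

lemma rexp_tendsto : Tendsto rexp atTop (nhds 1) := by
  -- `1 - 2 / (b log (b+2)) ≤ rexp b ≤ 1`
  have hlow : ∀ᶠ b : ℕ in atTop, 1 - 2 / (b : ℝ) ≤ rexp b := by
    filter_upwards [eventually_ge_atTop 2] with b hb
    have hb' : (2 : ℝ) ≤ b := by exact_mod_cast hb
    have hl : 1 ≤ Real.log ((b : ℝ) + 2) := by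
      rw [Real.le_log_iff_exp_le (by linarith)]
      linarith [Real.exp_one_lt_d9]
    have h1 : Real.log ((b : ℝ) + 2) ≤ Real.log b + 2 / b := by
      have e : ((b : ℝ) + 2) = b * (1 + 2 / b) := by field_simp
      rw [e, Real.log_mul (by positivity) (by positivity)]
      have := Real.log_le_sub_one_of_pos (show 0 < 1 + 2 / (b : ℝ) by positivity)
      linarith
    rw [rexp, le_div_iff₀ (by linarith)]
    have h2 : 0 < 2 / (b : ℝ) := by positivity
    nlinarith
  have hup : ∀ᶠ b : ℕ in atTop, rexp b ≤ 1 := by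
    filter_upwards [eventually_ge_atTop 2] with b hb
    have hb' : (2 : ℝ) ≤ b := by exact_mod_cast hb
    rw [rexp, div_le_one (Real.log_pos (by linarith))]
    exact Real.log_le_log (by linarith) (by linarith)
  have hl : Tendsto (fun b : ℕ => 1 - 2 / (b : ℝ)) atTop (nhds 1) := by
    have := (tendsto_const_nhds (x := (1 : ℝ))).sub (tendsto_const_div_atTop_nhds_zero_nat (2 : ℝ))
    simpa using this
  exact tendsto_of_tendsto_of_tendsto_of_le_of_le' hl tendsto_const_nhds hlow hup

lemma A0_dim :
    dimH {β : ℝ | 1 < β ∧ BddAbove (Set.range fun n : ℕ => runLenStar β n)} = 1 := by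
  refine le_antisymm ((dimH_mono (subset_univ _)).trans_eq Real.dimH_univ) ?_
  have h1 : Tendsto (fun b => ENNReal.ofReal (rexp b)) atTop (nhds (ENNReal.ofReal 1)) :=
    ENNReal.tendsto_ofReal rexp_tendsto
  rw [ENNReal.ofReal_one] at h1
  refine le_of_tendsto h1 ?_
  filter_upwards [eventually_ge_atTop 2] with b hb
  exact (dim_EB b hb).trans (dimH_mono (EB_subset b (by omega)))

/-- Proposition 8.1. The set
`A₀ = {β > 1 : (ℓ_n(β))_{n≥1} is bounded}` is Lebesgue null and has Hausdorff
dimension 1. -/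
theorem size_A0 :
    volume {β : ℝ | 1 < β ∧ BddAbove (Set.range fun n : ℕ => runLenStar β n)} = 0 ∧
    dimH {β : ℝ | 1 < β ∧ BddAbove (Set.range fun n : ℕ => runLenStar β n)} = 1 := by
  exact ⟨A0_null, A0_dim⟩
end
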